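/- arXiv:2510.11311 — 2 statements merged into one kernel-verified Lean document; each statement's English description precedes it below -/
import Mathlib

section
/- For every k there exists d (one may take d polynomial in k, e.g. d = 27·k^8000 suffices) such that every digraph D with minimum out-degree at least d contains a subdigraph D' with minimum out-degree at least k that contains no orientation of the 3-cycle C_3 and no orientation of the 5-cycle C_5 as a subdigraph; in particular, every orientation of C_3 and every orientation of C_5 is avoidable. -/
/-- A digraph: a set of vertices together with arcs (ordered pairs of
distinct vertices) between them, inside an ambient vertex type `α`. -/
structure Digraph' (α : Type) where
  verts : Set α
  Adj : α → α → Prop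
  ne_of_adj : ∀ ⦃u v : α⦄, Adj u v → u ≠ v
  mem_verts_left : ∀ ⦃u v : α⦄, Adj u v → u ∈ verts
  mem_verts_right : ∀ ⦃u v : α⦄, Adj u v → v ∈ verts

namespace Digraph'

variable {α β : Type}

/-- The out-neighbourhood of a vertex. -/
def outNbrs (D : Digraph' α) (v : α) : Set α := {u | D.Adj v u}

/-- The in-neighbourhood of a vertex. -/
def inNbrs (D : Digraph' α) (v : α) : Set α := {u | D.Adj u v}

/-- The set `s` has at least `k` elements (also meaningful for infinite sets). -/
def AtLeast (s : Set α) (k : ℕ) : Prop := ∃ t : Finset α, ↑t ⊆ s ∧ k ≤ t.card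

/-- Every vertex of `D` has out-degree at least `k`, i.e. `δ⁺(D) ≥ k`. -/
def MinOutDegAtLeast (D : Digraph' α) (k : ℕ) : Prop :=
  ∀ v ∈ D.verts, AtLeast (D.outNbrs v) k

/-- `D'` is a subdigraph of `D`. -/
def IsSubdigraph (D' D : Digraph' α) : Prop :=
  D'.verts ⊆ D.verts ∧ ∀ ⦃u v : α⦄, D'.Adj u v → D.Adj u v

/-- `D` contains a copy of the pattern digraph `F` (a pattern digraph has
vertex set all of its ambient type). -/
def HasCopy (D : Digraph' α) (F : Digraph' β) : Prop :=
  ∃ f : β → α, Function.Injective f ∧ (∀ w : β, f w ∈ D.verts) ∧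
    ∀ ⦃u v : β⦄, F.Adj u v → D.Adj (f u) (f v)

/-- The digraph `F` is avoidable: there is `d_F : ℕ → ℕ` such that every
(nonempty) digraph of minimum out-degree at least `d_F k` contains an
`F`-free subdigraph of minimum out-degree at least `k`. -/
def Avoidable (F : Digraph' β) : Prop :=
  ∃ dF : ℕ → ℕ, ∀ (α : Type) (D : Digraph' α) (k : ℕ), D.verts.Nonempty →
    D.MinOutDegAtLeast (dF k) →
    ∃ D' : Digraph' α, D'.IsSubdigraph D ∧ D'.verts.Nonempty ∧
      D'.MinOutDegAtLeast k ∧ ¬ D'.HasCopy F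

end Digraph'

open Digraph'

/-- `F` is an orientation of the cycle `C_n`: its vertex set is all of `Fin n`
and each edge of the `n`-cycle receives exactly one direction. -/
def IsCycleOrientation {n : ℕ} [NeZero n] (F : Digraph' (Fin n)) : Prop :=
  F.verts = Set.univ ∧
  (∀ ⦃u v : Fin n⦄, F.Adj u v → v = u + 1 ∨ u = v + 1) ∧
  ∀ i : Fin n, Xor' (F.Adj i (i + 1)) (F.Adj (i + 1) i)

section OutAssignments
open Finset
open scoped Classical

/-- Every non-sink vertex has at least `d` out-neighbours. -/
def Big {V : Type} (d : ℕ) (N : V → Finset V) : Prop := ∀ v, N v = ∅ ∨ d ≤ (N v).card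

/-- `M` is a pruning of `N` in which every non-sink keeps at least `k` out-neighbours. -/
def SubA {V : Type} (k : ℕ) (N M : V → Finset V) : Prop :=
  ∀ v, M v ⊆ N v ∧ (N v = ∅ ∨ k ≤ (M v).card)

/-- No walk of length `m` has its two ends of the same colour. -/
def Good {V κ : Type} (N : V → Finset V) (m : ℕ) (c : V → κ) : Prop :=
  ∀ x : ℕ → V, (∀ i < m, x (i + 1) ∈ N (x i)) → c (x 0) ≠ c (x m)

lemma SubA.trans {V : Type} {d k : ℕ} {N N' N'' : V → Finset V} (hd : 1 ≤ d)
    (h : SubA d N N') (h' : SubA k N' N'') : SubA k N N'' := by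
  intro v
  refine ⟨(h' v).1.trans (h v).1, ?_⟩
  rcases (h v).2 with h1 | h1
  · exact Or.inl h1
  · rcases (h' v).2 with h2 | h2
    · rw [h2] at h1; simp at h1; omega
    · exact Or.inr h2

lemma SubA.big {V : Type} {k : ℕ} {N N' : V → Finset V} (h : SubA k N N') : Big k N' := by
  intro v
  rcases (h v).2 with h1 | h1
  · left
    have := (h v).1
    rw [h1] at this
    exact Finset.subset_empty.1 this
  · exact Or.inr h1

lemma Big.mono {V : Type} {k d : ℕ} {N : V → Finset V} (h : Big d N) (hk : k ≤ d) : Big k N :=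
  fun v => (h v).imp id (fun h => hk.trans h)

lemma Good.mono {V κ : Type} {m : ℕ} {N N' : V → Finset V} {c : V → κ} (h : Good N m c)
    (hs : ∀ v, N' v ⊆ N v) : Good N' m c :=
  fun x hx => h x (fun i hi => hs _ (hx i hi))

lemma Good.comp {V κ κ' : Type} {m : ℕ} {N : V → Finset V} {c : V → κ} {c' : V → κ'}
    (h : Good N m c) (e : κ' → κ) (he : ∀ v, e (c' v) = c v) : Good N m c' := by
  intro x hx h2
  apply h x hx
  rw [← he, ← he, h2]

/-- Pigeonhole: a popular colour. -/
lemma exists_popular {V κ : Type} [Fintype κ] (s : Finset V) (hs : s.Nonempty) (c : V → κ) :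
    ∃ a : κ, s.card ≤ Fintype.card κ * (s.filter (fun u => c u = a)).card := by
  obtain ⟨x, hx⟩ := hs
  by_contra! h
  have h1 : s.card = ∑ a : κ, (s.filter (fun u => c u = a)).card :=
    Finset.card_eq_sum_card_fiberwise (fun x _ => Finset.mem_coe.2 (Finset.mem_univ _))
  have hne : (Finset.univ : Finset κ).Nonempty := ⟨c x, Finset.mem_univ _⟩
  have h2 : ∑ a : κ, Fintype.card κ * (s.filter (fun u => c u = a)).card
      < ∑ a : κ, s.card := Finset.sum_lt_sum_of_nonempty hne (fun a _ => h a)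
  rw [← Finset.mul_sum, ← h1] at h2
  simp at h2

/-- Pruning to monochromatic out-neighbourhoods. -/
lemma homog {V κ : Type} [Fintype κ] (N : V → Finset V) (c : V → κ) (k : ℕ)
    (hN : Big (Fintype.card κ * k) N) :
    ∃ N', SubA k N N' ∧ ∀ v, ∀ u ∈ N' v, ∀ w ∈ N' v, c u = c w := by
  have : ∀ v, ∃ s ⊆ N v, (N v = ∅ ∨ k ≤ s.card) ∧ ∀ u ∈ s, ∀ w ∈ s, c u = c w := by
    intro v
    rcases (N v).eq_empty_or_nonempty with h | h
    · exact ⟨∅, by simp, Or.inl h, by simp⟩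
    · obtain ⟨a, ha⟩ := exists_popular (N v) h c
      refine ⟨(N v).filter (fun u => c u = a), Finset.filter_subset _ _, Or.inr ?_, ?_⟩
      · have h1 := ((hN v).resolve_left h.ne_empty).trans ha
        have hp : 0 < Fintype.card κ := Fintype.card_pos_iff.2 ⟨a⟩
        exact Nat.le_of_mul_le_mul_left h1 hp
      · intro u hu w hw
        simp at hu hw
        rw [hu.2, hw.2]
  choose N' h1 h2 h3 using this
  exact ⟨N', fun v => ⟨h1 v, h2 v⟩, h3⟩

/-- Colouring acyclic out-assignments. -/
lemma acyclic_color {V : Type} (n : ℕ) [NeZero n] (N : V → Finset V) (h : V → ℕ)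
    (hh : ∀ v, ∀ u ∈ N v, h u < h v) (t : ℕ) :
    ∃ c : V → ZMod n, ∀ v, h v < t → (N v).Nonempty →
      ∃ a, c v = a + 1 ∧ (N v).card ≤ n * ((N v).filter (fun u => c u = a)).card := by
  induction t with
  | zero => exact ⟨fun _ => 0, by simp⟩
  | succ t ih =>
    obtain ⟨c, hc⟩ := ih
    have : ∀ v, ∃ a : ZMod n, (N v).Nonempty →
        (N v).card ≤ n * ((N v).filter (fun u => c u = a)).card := by
      intro v
      by_cases hv : (N v).Nonempty
      · obtain ⟨a, ha⟩ := exists_popular (N v) hv c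
        rw [ZMod.card] at ha
        exact ⟨a, fun _ => by convert ha⟩
      · exact ⟨0, fun h => absurd h hv⟩
    choose a ha using this
    refine ⟨fun v => if h v = t then a v + 1 else c v, ?_⟩
    intro v hv hne
    have key : ∀ b, (N v).filter (fun u => (if h u = t then a u + 1 else c u) = b)
        = (N v).filter (fun u => c u = b) := by
      intro b
      apply Finset.filter_congr
      intro u hu
      have := hh v u hu
      rw [if_neg (by omega)]
    by_cases hvt : h v = t
    · refine ⟨a v, by simp [hvt], ?_⟩
      rw [key]
      exact ha v hne
    · obtain ⟨b, hb, hb2⟩ := hc v (by omega) hne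
      refine ⟨b, by simp [hvt, hb], ?_⟩
      rw [key]
      exact hb2

lemma acyclic_good {V : Type} [Fintype V] (m k : ℕ) (N : V → Finset V) (h : V → ℕ)
    (hh : ∀ v, ∀ u ∈ N v, h u < h v) (hN : Big ((m + 2) * k) N) :
    ∃ N', SubA k N N' ∧ ∃ c : V → ZMod (m + 2), Good N' (m + 1) c := by
  obtain ⟨c, hc⟩ := acyclic_color (m + 2) N h hh (Finset.univ.sup h + 1)
  refine ⟨fun v => (N v).filter (fun u => c v = c u + 1), ?_, c, ?_⟩
  · intro v
    refine ⟨Finset.filter_subset _ _, ?_⟩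
    rcases (N v).eq_empty_or_nonempty with h0 | h0
    · exact Or.inl h0
    · right
      obtain ⟨a, ha, ha2⟩ := hc v (Nat.lt_succ_of_le (Finset.le_sup (Finset.mem_univ v))) h0
      have h1 := ((hN v).resolve_left h0.ne_empty).trans ha2
      have h2 := Nat.le_of_mul_le_mul_left h1 (by omega)
      refine h2.trans (Finset.card_le_card ?_)
      intro u
      simp only [Finset.mem_filter]
      rintro ⟨hu, hu2⟩
      exact ⟨hu, by rw [ha, hu2]⟩
  · intro x hx heq
    have : ∀ i ≤ m + 1, c (x 0) = c (x i) + (i : ℕ) := by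
      intro i
      induction i with
      | zero => simp
      | succ i ih =>
        intro hi
        have h1 := hx i (by omega)
        simp only [Finset.mem_filter] at h1
        rw [ih (by omega), h1.2]
        push_cast
        ring
    have h2 := this (m + 1) le_rfl
    rw [heq] at h2
    have h3 : ((m + 1 : ℕ) : ZMod (m + 2)) = 0 := by
      simpa using h2
    rw [ZMod.natCast_eq_zero_iff] at h3
    have := Nat.le_of_dvd (by omega) h3
    omega
/-- Weighted removal order. -/
lemma removal {R F : Type} [Fintype R] [Fintype F] (ρ : F → R) (N : F → Finset R) (M q : ℕ)
    (hM : 1 ≤ M) (hρ : ∀ r, (Finset.univ.filter (fun f => ρ f = r)).card ≤ M)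
    (n : ℕ) : ∀ R' : Finset R, R'.card = n →
    ∃ (rank : R → ℕ) (w : F → R → ℝ),
      (∀ f x, 0 ≤ w f x) ∧ (∀ x ∈ R', ∑ f, w f x ≤ 1) ∧
      (∀ f x, w f x ≠ 0 → x ∈ N f ∧ x ∈ R' ∧ ρ f ∈ R' ∧ rank x < rank (ρ f)) ∧
      (∀ f, ρ f ∈ R' →
        q ≤ ((N f ∩ R').filter (fun x => rank (ρ f) < rank x)).card ∨
        ∑ j ∈ Finset.range ((N f ∩ R').card + 1), (if q + 1 ≤ j then 1 / ((M : ℝ) * j) else 0)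
          ≤ ∑ x ∈ R', w f x) := by
  induction n with
  | zero =>
    intro R' hR'
    rw [Finset.card_eq_zero] at hR'
    subst hR'
    exact ⟨fun _ => 0, fun _ _ => 0, by simp, by simp, by simp, by simp⟩
  | succ n ih =>
    intro R' hR'
    have hne : R'.Nonempty := by
      rw [← Finset.card_pos]; omega
    have hMpos : (0 : ℝ) < M := by exact_mod_cast hM
    -- the weight
    let u : F → R → ℝ := fun f x =>
      if ρ f ∈ R' ∧ x ∈ N f ∧ q + 1 ≤ (N f ∩ R').card then 1 / ((M : ℝ) * (N f ∩ R').card) else 0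
    have hu0 : ∀ f x, 0 ≤ u f x := by
      intro f x
      simp only [u]
      split_ifs
      · positivity
      · exact le_rfl
    have husum : ∀ f, ∑ x ∈ R', u f x ≤ if ρ f ∈ R' then 1 / (M : ℝ) else 0 := by
      intro f
      by_cases h1 : ρ f ∈ R'
      · by_cases h2 : q + 1 ≤ (N f ∩ R').card
        · have hc : (0 : ℝ) < (N f ∩ R').card := by
            have : 0 < (N f ∩ R').card := by omega
            exact_mod_cast this
          have : ∑ x ∈ R', u f x = ∑ x ∈ R' ∩ N f, 1 / ((M : ℝ) * (N f ∩ R').card) := by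
            rw [← Finset.filter_mem_eq_inter, Finset.sum_filter]
            apply Finset.sum_congr rfl
            intro x _
            have h2' : q < (N f ∩ R').card := h2
            simp [u, h1, h2']
          rw [this, Finset.sum_const, nsmul_eq_mul, if_pos h1, Finset.inter_comm R']
          apply le_of_eq
          field_simp
        · have : ∑ x ∈ R', u f x = 0 := by
            apply Finset.sum_eq_zero
            intro x _
            simp only [u]
            rw [if_neg]
            tauto
          rw [this, if_pos h1]
          positivity
      · simp [u, h1]
    have htot : ∑ x ∈ R', ∑ f, u f x ≤ ∑ x ∈ R', (1 : ℝ) := by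
      rw [Finset.sum_comm]
      calc ∑ f, ∑ x ∈ R', u f x ≤ ∑ f, (if ρ f ∈ R' then 1 / (M : ℝ) else 0) :=
            Finset.sum_le_sum (fun f _ => husum f)
        _ = ((Finset.univ.filter (fun f => ρ f ∈ R')).card : ℝ) * (1 / (M : ℝ)) := by
            rw [← Finset.sum_filter, Finset.sum_const, nsmul_eq_mul]
        _ ≤ (R'.card * M : ℕ) * (1 / (M : ℝ)) := by
            apply mul_le_mul_of_nonneg_right _ (by positivity)
            have : (Finset.univ.filter (fun f => ρ f ∈ R')).card ≤ R'.card * M := by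
              rw [mul_comm]
              refine Finset.card_le_mul_card_image_of_maps_to (f := ρ) (fun f hf => ?_) M ?_
              · simpa using hf
              · intro r _
                refine le_trans (Finset.card_le_card ?_) (hρ r)
                intro f
                simp
            exact_mod_cast this
        _ = ∑ x ∈ R', (1 : ℝ) := by
            simp
            field_simp
    obtain ⟨x0, hx0, hx0w⟩ := Finset.exists_le_of_sum_le hne htot
    obtain ⟨rank, w, hw0, hw1, hw2, hw3⟩ := ih (R'.erase x0) (by
      rw [Finset.card_erase_of_mem hx0]; omega)
    let rank' : R → ℕ := fun x => if x = x0 then 0 else rank x + 1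
    have hr0 : rank' x0 = 0 := by simp [rank']
    have hr1 : ∀ x, x ≠ x0 → rank' x = rank x + 1 := by
      intro x hx; simp [rank', hx]
    let w' : F → R → ℝ := fun f x => if x = x0 then (if ρ f = x0 then 0 else u f x) else w f x
    have hwx0 : ∀ f, ρ f ≠ x0 → w' f x0 = u f x0 := by
      intro f hf; simp [w', hf]
    have hwx1 : ∀ f x, x ≠ x0 → w' f x = w f x := by
      intro f x hx; simp [w', hx]
    have hsum : ∀ f, ∑ x ∈ R', w' f x = w' f x0 + ∑ x ∈ R'.erase x0, w f x := by
      intro f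
      rw [← Finset.add_sum_erase _ _ hx0]
      congr 1
      apply Finset.sum_congr rfl
      intro x hx
      exact hwx1 f x (Finset.ne_of_mem_erase hx)
    have hw'0 : ∀ f x, 0 ≤ w' f x := by
      intro f x
      simp only [w']
      split_ifs
      · exact le_rfl
      · exact hu0 _ _
      · exact hw0 _ _
    refine ⟨rank', w', hw'0, ?_, ?_, ?_⟩
    · intro x hx
      by_cases hxx : x = x0
      · subst hxx
        refine le_trans (Finset.sum_le_sum (fun f _ => ?_)) hx0w
        simp only [w', if_true]
        split_ifs
        · exact hu0 _ _
        · exact le_rfl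
      · simp only [hwx1 _ _ hxx]
        exact hw1 x (Finset.mem_erase.2 ⟨hxx, hx⟩)
    · intro f x hfx
      by_cases hxx : x = x0
      · subst hxx
        have hf : ρ f ≠ x := by
          intro hf; simp [w', hf] at hfx
        rw [hwx0 f hf] at hfx
        have : ρ f ∈ R' ∧ x ∈ N f ∧ q + 1 ≤ (N f ∩ R').card := by
          by_contra hcon
          exact hfx (by simp only [u]; rw [if_neg hcon])
        refine ⟨this.2.1, hx0, this.1, ?_⟩
        rw [hr0, hr1 _ hf]
        omega
      · rw [hwx1 _ _ hxx] at hfx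
        obtain ⟨h1, h2, h4, h3⟩ := hw2 f x hfx
        refine ⟨h1, Finset.mem_of_mem_erase h2, Finset.mem_of_mem_erase h4, ?_⟩
        rw [hr1 _ hxx]
        rw [hr1 _ (Finset.ne_of_mem_erase h4)]; omega
    · intro f hf
      by_cases hfx : ρ f = x0
      · by_cases hq : q + 1 ≤ (N f ∩ R').card
        · left
          have : (N f ∩ R').erase x0 ⊆ (N f ∩ R').filter (fun x => rank' (ρ f) < rank' x) := by
            intro x hx
            rw [Finset.mem_erase] at hx
            rw [Finset.mem_filter]
            refine ⟨hx.2, ?_⟩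
            rw [hfx, hr0, hr1 _ hx.1]
            omega
          have h2 := Finset.card_le_card this
          have h3 := Finset.pred_card_le_card_erase (s := N f ∩ R') (a := x0)
          omega
        · right
          have : ∑ j ∈ Finset.range ((N f ∩ R').card + 1),
              (if q + 1 ≤ j then 1 / ((M : ℝ) * j) else 0) = 0 := by
            apply Finset.sum_eq_zero
            intro j hj
            rw [Finset.mem_range] at hj
            rw [if_neg (by omega)]
          rw [this]
          exact Finset.sum_nonneg (fun x _ => hw'0 f x)
      · rcases hw3 f (Finset.mem_erase.2 ⟨hfx, hf⟩) with h1 | h1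
        · left
          refine h1.trans (Finset.card_le_card ?_)
          intro x
          simp only [Finset.mem_filter, Finset.mem_inter, Finset.mem_erase]
          rintro ⟨⟨ha, hb, hc⟩, hd⟩
          refine ⟨⟨ha, hc⟩, ?_⟩
          rw [hr1 _ hfx, hr1 _ hb]
          omega
        · right
          rw [hsum, hwx0 f hfx]
          by_cases hxN : x0 ∈ N f
          · have hcard : (N f ∩ R'.erase x0).card + 1 = (N f ∩ R').card := by
              rw [Finset.inter_erase]
              exact Finset.card_erase_add_one (Finset.mem_inter.2 ⟨hxN, hx0⟩)
            rw [hcard] at h1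
            rw [Finset.sum_range_succ]
            have : (if q + 1 ≤ (N f ∩ R').card then 1 / ((M : ℝ) * (N f ∩ R').card) else 0)
                = u f x0 := by
              simp [u, hf, hxN]
            rw [this]
            linarith
          · have hcard : (N f ∩ R'.erase x0) = (N f ∩ R') := by
              rw [Finset.inter_erase]
              exact Finset.erase_eq_of_notMem (by simp [hxN])
            rw [hcard] at h1
            have := hu0 f x0
            linarith

lemma harmonic_threshold (q K M : ℕ) (hM : 1 ≤ M) : ∃ d : ℕ, 1 ≤ d ∧ ∀ e ≥ d, (K : ℝ) ≤
    ∑ j ∈ Finset.range (e + 1), (if q + 1 ≤ j then 1 / ((M : ℝ) * j) else 0) := by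
  have h := Real.tendsto_sum_range_one_div_nat_succ_atTop
  have hMpos : (0 : ℝ) < M := by exact_mod_cast hM
  obtain ⟨d, hd⟩ := ((h.eventually_ge_atTop
    (M * K + ∑ i ∈ Finset.range q, (1 / ((i : ℝ) + 1)))).and
    (Filter.eventually_ge_atTop (q + 1))).exists
  refine ⟨d, by omega, ?_⟩
  intro e he
  have h1 : ∑ j ∈ Finset.range (d + 1), (if q + 1 ≤ j then 1 / ((M : ℝ) * j) else 0)
      = (1 / (M : ℝ)) * (∑ i ∈ Finset.Ico q d, (1 / ((i : ℝ) + 1))) := by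
    rw [Finset.sum_range_succ']
    have : Finset.Ico q d = (Finset.range d).filter (fun i => q ≤ i) := by
      ext i; simp; omega
    rw [this, Finset.sum_filter, Finset.mul_sum]
    simp only [Nat.add_le_add_iff_right, Nat.le_zero_eq, Nat.add_eq_zero_iff, one_ne_zero,
      and_false, if_false, add_zero]
    apply Finset.sum_congr rfl
    intro i _
    split_ifs
    · push_cast
      field_simp
    · simp
  rw [Finset.sum_Ico_eq_sub _ (by omega)] at h1
  have h2 : ∑ j ∈ Finset.range (d + 1), (if q + 1 ≤ j then 1 / ((M : ℝ) * j) else 0) ≤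
      ∑ j ∈ Finset.range (e + 1), (if q + 1 ≤ j then 1 / ((M : ℝ) * j) else 0) := by
    apply Finset.sum_le_sum_of_subset_of_nonneg
    · intro i; simp; omega
    · intro i _ _
      split_ifs
      · positivity
      · exact le_rfl
  refine le_trans ?_ h2
  rw [h1]
  have h3 : (M : ℝ) * K ≤ ∑ i ∈ Finset.range d, (1 / ((i : ℝ) + 1))
      - ∑ i ∈ Finset.range q, (1 / ((i : ℝ) + 1)) := by linarith [hd.1]
  calc (K : ℝ) = 1 / (M : ℝ) * (M * K) := by field_simp
    _ ≤ _ := by gcongr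

lemma agent (q K M : ℕ) (hM : 1 ≤ M) : ∃ d : ℕ, 1 ≤ d ∧ ∀ (R F : Type) [Fintype R] [Fintype F]
    (ρ : F → R) (N : F → Finset R),
    (∀ r, (Finset.univ.filter (fun f => ρ f = r)).card ≤ M) →
    (∀ f, N f = ∅ ∨ d ≤ (N f).card) →
    ∃ (rank : R → ℕ) (P : F → Finset R),
      (∀ f, N f = ∅ ∨ q ≤ ((N f).filter (fun x => rank (ρ f) < rank x)).card ∨
        (P f ⊆ N f ∧ (P f).card = K ∧ ∀ x ∈ P f, rank x < rank (ρ f))) ∧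
      (∀ f f' x, x ∈ P f → x ∈ P f' → f = f') := by
  obtain ⟨d, hd1, hd⟩ := harmonic_threshold q K M hM
  refine ⟨d, hd1, ?_⟩
  intro R F _ _ ρ N hρ hN
  obtain ⟨rank, w, hw0, hw1, hw2, hw3⟩ := removal ρ N M q hM hρ _ Finset.univ rfl
  simp only [Finset.mem_univ, Finset.inter_univ, true_and, forall_const] at hw1 hw2 hw3
  let B : Type := {f : F // (K : ℝ) ≤ ∑ x, w f x}
  let t : B × Fin K → Finset R := fun p => Finset.univ.filter (fun x => w p.1.1 x ≠ 0)
  have hall : ∀ s : Finset (B × Fin K), s.card ≤ (s.biUnion t).card := by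
    intro s
    have h1 : s.card ≤ K * (s.image Prod.fst).card := by
      refine Finset.card_le_mul_card_image_of_maps_to (f := Prod.fst)
        (fun p hp => Finset.mem_image_of_mem _ hp) K ?_
      intro b _
      have : (s.filter (fun p => p.1 = b)).card ≤ (Finset.univ : Finset (Fin K)).card := by
        apply Finset.card_le_card_of_injOn Prod.snd (by simp)
        rintro ⟨a, i⟩ h ⟨a', i'⟩ h' he
        simp at h h' he
        simp [h.2, h'.2, he]
      simpa using this
    have h2 : ((K * (s.image Prod.fst).card : ℕ) : ℝ) ≤ ((s.biUnion t).card : ℝ) := by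
      calc ((K * (s.image Prod.fst).card : ℕ) : ℝ) = ∑ b ∈ s.image Prod.fst, (K : ℝ) := by
            rw [Finset.sum_const, nsmul_eq_mul]; push_cast; ring
        _ ≤ ∑ b ∈ s.image Prod.fst, ∑ x, w b.1 x := Finset.sum_le_sum (fun b _ => b.2)
        _ = ∑ b ∈ s.image Prod.fst, ∑ x ∈ s.biUnion t, w b.1 x := by
            apply Finset.sum_congr rfl
            intro b hb
            symm
            apply Finset.sum_subset (Finset.subset_univ _)
            intro x _ hx
            by_contra hne
            apply hx
            rw [Finset.mem_image] at hb
            obtain ⟨p, hp, rfl⟩ := hb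
            rw [Finset.mem_biUnion]
            exact ⟨p, hp, by simp [t, hne]⟩
        _ = ∑ x ∈ s.biUnion t, ∑ b ∈ s.image Prod.fst, w b.1 x := Finset.sum_comm
        _ ≤ ∑ x ∈ s.biUnion t, (1 : ℝ) := by
            apply Finset.sum_le_sum
            intro x _
            refine le_trans ?_ (hw1 x)
            have : ∑ b ∈ s.image Prod.fst, w b.1 x
                = ∑ f ∈ (s.image Prod.fst).image Subtype.val, w f x := by
              symm
              apply Finset.sum_image
              intro a _ b _ h
              exact Subtype.ext h
            rw [this]
            exact Finset.sum_le_sum_of_subset_of_nonneg (Finset.subset_univ _)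
              (fun f _ _ => hw0 f x)
        _ = _ := by simp
    exact h1.trans (by exact_mod_cast h2)
  obtain ⟨φ, hφ, hφt⟩ := (Finset.all_card_le_biUnion_card_iff_exists_injective t).1 hall
  let P : F → Finset R := fun f =>
    if h : (K : ℝ) ≤ ∑ x, w f x then Finset.univ.image (fun i : Fin K => φ (⟨f, h⟩, i)) else ∅
  refine ⟨rank, P, ?_, ?_⟩
  · intro f
    rcases hN f with h | h
    · exact Or.inl h
    · right
      rcases hw3 f with h1 | h1
      · exact Or.inl h1
      · right
        have hK : (K : ℝ) ≤ ∑ x, w f x := (hd _ h).trans h1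
        have hP : P f = Finset.univ.image (fun i : Fin K => φ (⟨f, hK⟩, i)) := by
          simp only [P]; rw [dif_pos hK]
        have hx : ∀ x ∈ P f, w f x ≠ 0 := by
          intro x hx
          rw [hP, Finset.mem_image] at hx
          obtain ⟨i, _, rfl⟩ := hx
          have := hφt (⟨f, hK⟩, i)
          simpa [t] using this
        refine ⟨fun x h => (hw2 f x (hx x h)).1, ?_, fun x h => (hw2 f x (hx x h)).2⟩
        rw [hP, Finset.card_image_of_injective]
        · simp
        · intro i j hij
          have := hφ hij
          simpa using this
  · intro f f' x hx hx'
    simp only [P] at hx hx'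
    split_ifs at hx hx' with h h'
    · rw [Finset.mem_image] at hx hx'
      obtain ⟨i, _, rfl⟩ := hx
      obtain ⟨j, _, hj⟩ := hx'
      have := hφ hj
      simp at this
      exact congrArg Subtype.val this.1.symm
    all_goals simp at hx hx'

lemma seqLemma {V τ : Type} (N0 : V → Finset V) (Q : τ → (V → Finset V) → Prop) (g : ℕ → ℕ)
    (hg : ∀ k, 1 ≤ k → 1 ≤ g k)
    (hQ : ∀ t N N', (∀ v, N' v ⊆ N v) → Q t N → Q t N')
    (step : ∀ t k, 1 ≤ k → ∀ N : V → Finset V, (∀ v, N v ⊆ N0 v) → Big (g k) N →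
      ∃ N', SubA k N N' ∧ Q t N') (L : List τ) :
    ∀ k, 1 ≤ k → ∀ N : V → Finset V, (∀ v, N v ⊆ N0 v) → Big (g^[L.length] k) N →
      ∃ N', SubA k N N' ∧ ∀ t ∈ L, Q t N' := by
  induction L with
  | nil =>
    intro k hk N hN hB
    exact ⟨N, fun v => ⟨subset_rfl, hB v⟩, by simp⟩
  | cons t L ih =>
    intro k hk N hN hB
    simp only [List.length_cons, Function.iterate_succ, Function.comp] at hB
    obtain ⟨N1, h1, h2⟩ := ih (g k) (hg k hk) N hN hB
    obtain ⟨N2, h3, h4⟩ := step t k hk N1 (fun v => (h1 v).1.trans (hN v)) h1.big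
    refine ⟨N2, h1.trans (hg k hk) h3, ?_⟩
    intro t' ht'
    rcases List.mem_cons.1 ht' with rfl | h
    · exact h4
    · have h5 := h2 t' h
      exact hQ _ _ _ (fun v => (h3 v).1) h5

/-- Keep only the out-neighbourhoods of vertices satisfying `A`. -/
noncomputable def restr {V : Type} (A : V → Prop) (N : V → Finset V) : V → Finset V :=
  fun v => if A v then N v else ∅

lemma mem_restr {V : Type} {A : V → Prop} {N : V → Finset V} {v u : V} :
    u ∈ restr A N v ↔ A v ∧ u ∈ N v := by
  unfold restr
  split_ifs with h <;> simp [h]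

lemma restr_big {V : Type} (A : V → Prop) {N : V → Finset V} {k : ℕ} (h : Big k N) :
    Big k (restr A N) := by
  intro v
  unfold restr
  split_ifs
  · exact h v
  · exact Or.inl rfl

lemma restr_step {V : Type} (A : V → Prop) {N N1 : V → Finset V} {k : ℕ} (hB : Big k N)
    (h : SubA k (restr A N) N1) : ∃ N', SubA k N N' ∧ ∀ v, restr A N' v ⊆ N1 v := by
  refine ⟨fun v => if A v then N1 v else N v, ?_, ?_⟩
  · intro v
    have := h v
    unfold restr at this
    by_cases hA : A v
    · simpa [hA] using this
    · simpa [hA] using hB v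
  · intro v u
    rw [mem_restr]
    rintro ⟨hA, hu⟩
    simpa [hA] using hu

lemma zmod_val_succ (m : ℕ) (a : ZMod (m + 1)) (h : a + 1 ≠ 0) : (a + 1).val = a.val + 1 := by
  have ha : a.val < m + 1 := ZMod.val_lt a
  by_cases hc : a.val = m
  · exfalso
    apply h
    rw [← ZMod.natCast_zmod_val a, hc]
    have := ZMod.natCast_self (m + 1)
    push_cast at this
    exact this
  · have h1 : ((a.val + 1 : ℕ) : ZMod (m + 1)) = a + 1 := by
      push_cast
      rw [ZMod.natCast_zmod_val]
    rw [← h1, ZMod.val_natCast_of_lt (by omega)]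

lemma rootmap {V : Type} [Fintype V] (m k1 : ℕ) (N : V → Finset V) (ℓ : V → ZMod (m + 1))
    (J : Finset (ZMod (m + 1))) (i0 : ZMod (m + 1)) (hi0 : i0 ∉ J)
    (hℓ : ∀ v, ∀ u ∈ N v, ℓ u = ℓ v + 1)
    (hp : ∀ v v' u, ℓ u ∈ J → u ∈ N v → u ∈ N v' → v = v')
    (hk : ∀ v, ℓ v + 1 ∈ J → (N v).card ≤ k1) :
    ∃ ρ : V → V, (∀ r, (Finset.univ.filter (fun f => ρ f = r)).card ≤ (k1 + 1) ^ (m + 1)) ∧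
      (∀ v, ∀ u ∈ N v, ℓ u ∈ J → ρ u = ρ v) ∧ (∀ u, ℓ u ∉ J → ρ u = u) := by
  have hex : ∀ u, ∃ v, (ℓ u ∈ J ∧ u ∈ N v) ∨ (v = u ∧ ¬ (ℓ u ∈ J ∧ ∃ v, u ∈ N v)) := by
    intro u
    by_cases h : ℓ u ∈ J ∧ ∃ v, u ∈ N v
    · obtain ⟨h1, v, hv⟩ := h
      exact ⟨v, Or.inl ⟨h1, hv⟩⟩
    · exact ⟨u, Or.inr ⟨rfl, h⟩⟩
  choose p hpp using hex
  have p1 : ∀ v u, u ∈ N v → ℓ u ∈ J → p u = v := by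
    intro v u hu hJ
    rcases hpp u with h | h
    · exact hp _ _ u hJ h.2 hu
    · exact absurd ⟨hJ, v, hu⟩ h.2
  have p2 : ∀ u, ℓ u ∉ J → p u = u := by
    intro u hJ
    rcases hpp u with h | h
    · exact absurd h.1 hJ
    · exact h.1
  have fib : ∀ v, (Finset.univ.filter (fun u => p u = v)).card ≤ k1 + 1 := by
    intro v
    by_cases hv : ℓ v + 1 ∈ J
    · have : Finset.univ.filter (fun u => p u = v) ⊆ insert v (N v) := by
        intro u hu
        simp only [Finset.mem_filter, Finset.mem_univ, true_and] at hu
        rw [Finset.mem_insert]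
        rcases hpp u with h | h
        · rw [hu] at h
          exact Or.inr h.2
        · left; rw [← h.1, hu]
      have h2 := Finset.card_le_card this
      have h3 := Finset.card_insert_le v (N v)
      have h4 := hk v hv
      omega
    · have : Finset.univ.filter (fun u => p u = v) ⊆ {v} := by
        intro u hu
        simp only [Finset.mem_filter, Finset.mem_univ, true_and] at hu
        rw [Finset.mem_singleton]
        rcases hpp u with h | h
        · rw [hu] at h
          exfalso
          apply hv
          rw [← hℓ v u h.2]
          exact h.1
        · rw [← h.1, hu]
      have h2 := Finset.card_le_card this
      simp at h2
      omega
  have fibn : ∀ n v, (Finset.univ.filter (fun u => p^[n] u = v)).card ≤ (k1 + 1) ^ n := by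
    intro n
    induction n with
    | zero =>
      intro v
      have : Finset.univ.filter (fun u => p^[0] u = v) ⊆ {v} := by
        intro u hu
        rw [Finset.mem_filter] at hu
        exact Finset.mem_singleton.2 hu.2
      simpa using Finset.card_le_card this
    | succ n ih =>
      intro v
      have h1 : (Finset.univ.filter (fun u => p^[n + 1] u = v)).card ≤
          (k1 + 1) * (Finset.univ.filter (fun u => p^[n] u = v)).card := by
        refine Finset.card_le_mul_card_image_of_maps_to (f := p) (fun u hu => ?_) (k1 + 1) ?_
        · rw [Finset.mem_filter] at hu ⊢
          exact ⟨Finset.mem_univ _, hu.2⟩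
        · intro r _
          refine le_trans (Finset.card_le_card ?_) (fib r)
          intro u
          simp
      rw [pow_succ, mul_comm]
      exact h1.trans (Nat.mul_le_mul_left _ (ih v))
  have stab : ∀ n u, (ℓ u - i0).val ≤ n → p (p^[n] u) = p^[n] u := by
    intro n
    induction n with
    | zero =>
      intro u hu
      have : ℓ u - i0 = 0 := by
        rw [← ZMod.val_eq_zero]; omega
      have : ℓ u = i0 := sub_eq_zero.1 this
      simp only [Function.iterate_zero, id]
      exact p2 u (by rw [this]; exact hi0)
    | succ n ih =>
      intro u hu
      by_cases hpu : p u = u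
      · rw [Function.iterate_fixed hpu, hpu]
      · rw [Function.iterate_succ_apply]
        apply ih
        rcases hpp u with h | h
        · have h1 := hℓ _ _ h.2
          have h2 := zmod_val_succ m (ℓ (p u) - i0) (by
            intro h0
            apply hi0
            have : ℓ u = i0 := by
              rw [h1]; linear_combination h0
            rw [← this]; exact h.1)
          have h3 : ℓ (p u) - i0 + 1 = ℓ u - i0 := by rw [h1]; ring
          rw [h3] at h2
          omega
        · exact absurd h.1 hpu
  refine ⟨p^[m + 1], fibn (m + 1), ?_, ?_⟩
  · intro v u hu hJ
    rw [Function.iterate_succ_apply, p1 v u hu hJ, Function.iterate_succ_apply', stab]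
    have := ZMod.val_lt (ℓ v - i0)
    omega
  · intro u hu
    exact Function.iterate_fixed (p2 u hu) _

lemma height_lt {V : Type} (m : ℕ) (N : V → Finset V) (ℓ : V → ZMod (m + 1))
    (J : Finset (ZMod (m + 1))) (i0 : ZMod (m + 1)) (hi0 : i0 ∉ J)
    (hℓ : ∀ v, ∀ u ∈ N v, ℓ u = ℓ v + 1) (r : V → ℕ)
    (h1 : ∀ v, ∀ u ∈ N v, ℓ u ∈ J → r u = r v) (h2 : ∀ v, ∀ u ∈ N v, ℓ u ∉ J → r u < r v) :
    ∀ v, ∀ u ∈ N v, r u * (m + 1) + (m - (ℓ u - i0).val) < r v * (m + 1) + (m - (ℓ v - i0).val) := by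
  intro v u hu
  by_cases hJ : ℓ u ∈ J
  · rw [h1 v u hu hJ]
    have h3 := zmod_val_succ m (ℓ v - i0) (by
      intro h0
      apply hi0
      have : ℓ u = i0 := by
        rw [hℓ v u hu]; linear_combination h0
      rw [← this]; exact hJ)
    have h4 : ℓ v - i0 + 1 = ℓ u - i0 := by rw [hℓ v u hu]; ring
    rw [h4] at h3
    have := ZMod.val_lt (ℓ u - i0)
    omega
  · have h3 := h2 v u hu hJ
    have h4 : (r u + 1) * (m + 1) ≤ r v * (m + 1) := Nat.mul_le_mul_right _ h3
    have h5 : (r u + 1) * (m + 1) = r u * (m + 1) + (m + 1) := by ring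
    omega

/-- The inductive statement on levelled out-assignments. -/
def SProp (m s : ℕ) : Prop :=
  ∃ (κ : Type) (_ : Fintype κ) (ds : ℕ → ℕ), ∀ k, 1 ≤ k → ∀ (V : Type) [Fintype V]
    (N : V → Finset V) (ℓ : V → ZMod (m + 1)) (J : Finset (ZMod (m + 1))),
    J ≠ Finset.univ → Jᶜ.card = s → (∀ v, ∀ u ∈ N v, ℓ u = ℓ v + 1) →
    (∀ v v' u, ℓ u ∈ J → u ∈ N v → u ∈ N v' → v = v') → Big (ds k) N →
    ∃ N', SubA k N N' ∧ ∃ c : V → κ, Good N' (m + 1) c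

lemma pattern_step {m s : ℕ} {κ : Type} {ds : ℕ → ℕ}
    (hS : ∀ k, 1 ≤ k → ∀ (V : Type) [Fintype V]
      (N : V → Finset V) (ℓ : V → ZMod (m + 1)) (J : Finset (ZMod (m + 1))),
      J ≠ Finset.univ → Jᶜ.card = s → (∀ v, ∀ u ∈ N v, ℓ u = ℓ v + 1) →
      (∀ v v' u, ℓ u ∈ J → u ∈ N v → u ∈ N v' → v = v') → Big (ds k) N →
      ∃ N', SubA k N N' ∧ ∃ c : V → κ, Good N' (m + 1) c)
    {V : Type} [Fintype V] (N : V → Finset V) (ℓ : V → ZMod (m + 1))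
    (J : Finset (ZMod (m + 1))) (hJ : J ≠ Finset.univ) (hJs : Jᶜ.card = s + 1)
    (hℓ : ∀ v, ∀ u ∈ N v, ℓ u = ℓ v + 1)
    (hp : ∀ v v' u, ℓ u ∈ J → u ∈ N v → u ∈ N v' → v = v')
    (r : V → ℕ) (t : ZMod (m + 1) → Bool)
    (hr1 : ∀ v, ∀ u ∈ N v, ℓ u ∈ J → r u = r v)
    (hr2 : ∀ v, ∀ u ∈ N v, ℓ u ∉ J → t (ℓ v) = true → r v < r u)
    (hr3 : ∀ v, ∀ u ∈ N v, ℓ u ∉ J → t (ℓ v) = false → r u < r v)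
    (hp2 : ∀ v v' u, ℓ u ∉ J → t (ℓ v) = false → t (ℓ v') = false →
      u ∈ N v → u ∈ N v' → v = v')
    (k : ℕ) (hk : 1 ≤ k) (hB : Big ((m + 2) * k + ds k) N) :
    ∃ N', SubA k N N' ∧ ∃ c : V → ZMod (m + 2) ⊕ κ, Good N' (m + 1) c := by
  obtain ⟨i0, hi0⟩ : ∃ i0, i0 ∉ J := by
    by_contra! h
    exact hJ (Finset.eq_univ_iff_forall.2 h)
  by_cases ht : ∀ i, i + 1 ∉ J → t i = false
  · obtain ⟨N', h1, c, h2⟩ := acyclic_good m k N _ (height_lt m N ℓ J i0 hi0 hℓ r hr1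
      (fun v u hu hu2 => hr3 v u hu hu2 (ht _ (by rw [← hℓ v u hu]; exact hu2))))
      (hB.mono (by omega))
    refine ⟨N', h1, fun v => Sum.inl (c v), ?_⟩
    intro x hx he
    exact h2 x hx (Sum.inl_injective he)
  · by_cases ht2 : ∀ i, i + 1 ∉ J → t i = true
    · have hle : ∀ v, r v ≤ Finset.univ.sup r := fun v => Finset.le_sup (Finset.mem_univ v)
      obtain ⟨N', h1, c, h2⟩ := acyclic_good m k N _ (height_lt m N ℓ J i0 hi0 hℓ
        (fun v => Finset.univ.sup r - r v)
        (fun v u hu hu2 => by rw [hr1 v u hu hu2])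
        (fun v u hu hu2 => by
          have := hr2 v u hu hu2 (ht2 _ (by rw [← hℓ v u hu]; exact hu2))
          have := hle u
          have := hle v
          omega))
        (hB.mono (by omega))
      refine ⟨N', h1, fun v => Sum.inl (c v), ?_⟩
      intro x hx he
      exact h2 x hx (Sum.inl_injective he)
    · push Not at ht ht2
      obtain ⟨j, hj, hjt⟩ := ht
      obtain ⟨i, hi, hit⟩ := ht2
      have hit' : t i = false := by simpa using hit
      have hne : j + 1 ≠ i + 1 := by
        intro h
        have : j = i := add_right_cancel h
        subst this
        exact hjt hit'
      obtain ⟨N', h1, c, h2⟩ := hS k hk V N ℓ (insert (i + 1) J) (by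
          intro h
          have := Finset.mem_univ (j + 1)
          rw [← h, Finset.mem_insert] at this
          tauto)
        (by
          rw [Finset.compl_insert, Finset.card_erase_of_mem (by simpa using hi), hJs]
          rfl) hℓ
        (by
          intro v v' u hu hv hv'
          by_cases huJ : ℓ u ∈ J
          · exact hp v v' u huJ hv hv'
          · rw [Finset.mem_insert] at hu
            have hu := hu.resolve_right huJ
            have a1 : ℓ v = i := by
              have := hℓ v u hv
              rw [hu] at this
              exact (add_right_cancel this).symm
            have a2 : ℓ v' = i := by
              have := hℓ v' u hv'
              rw [hu] at this
              exact (add_right_cancel this).symm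
            exact hp2 v v' u huJ (by rw [a1, hit']) (by rw [a2, hit']) hv hv')
        (hB.mono (by omega))
      refine ⟨N', h1, fun v => Sum.inr (c v), ?_⟩
      intro x hx he
      exact h2 x hx (Sum.inr_injective he)

lemma iterate_ge_one (g : ℕ → ℕ) (hg : ∀ k, 1 ≤ k → 1 ≤ g k) (n k : ℕ) (hk : 1 ≤ k) :
    1 ≤ g^[n] k := by
  induction n with
  | zero => simpa using hk
  | succ n ih =>
    rw [Function.iterate_succ_apply']
    exact hg _ ih

lemma S_step (m s : ℕ) (h : SProp m s) : SProp m (s + 1) := by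
  obtain ⟨κ, hκ, ds, hS⟩ := h
  let g : ℕ → ℕ := fun k => (m + 2) * k + ds k
  have hg : ∀ k, 1 ≤ k → 1 ≤ g k := by
    intro k hk
    have : 1 ≤ (m + 2) * k := Nat.one_le_iff_ne_zero.2 (by positivity)
    simp only [g]
    omega
  let L : List (ZMod (m + 1) → Bool) := (Finset.univ : Finset (ZMod (m + 1) → Bool)).toList
  let k1 : ℕ → ℕ := fun k => g^[L.length] k
  have hk1 : ∀ k, 1 ≤ k → 1 ≤ k1 k := fun k hk => iterate_ge_one g hg _ k hk
  choose da hda1 hda using fun k : ℕ =>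
    agent (k1 k) (k1 k) ((k1 k + 1) ^ (m + 1)) (Nat.one_le_pow _ _ (by omega))
  refine ⟨(ZMod (m + 1) → Bool) → (ZMod (m + 2) ⊕ κ), inferInstance, fun k => da k + k1 k, ?_⟩
  intro k hk V _ N ℓ J hJ hJs hℓ hp hB
  replace hB : Big (da k + k1 k) N := hB
  have hk1p := hk1 k hk
  obtain ⟨i0, hi0⟩ : ∃ i0, i0 ∉ J := by
    by_contra! h
    exact hJ (Finset.eq_univ_iff_forall.2 h)
  -- trimming
  have htrim : ∀ v, ∃ s ⊆ N v, (ℓ v + 1 ∈ J → N v = ∅ ∨ s.card = k1 k) ∧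
      (ℓ v + 1 ∉ J → s = N v) := by
    intro v
    by_cases hv : ℓ v + 1 ∈ J
    · rcases hB v with h | h
      · exact ⟨∅, by simp, fun _ => Or.inl h, fun h => absurd hv h⟩
      · obtain ⟨s, hs, hs2⟩ := Finset.exists_subset_card_eq (show k1 k ≤ (N v).card by omega)
        exact ⟨s, hs, fun _ => Or.inr hs2, fun h => absurd hv h⟩
    · exact ⟨N v, subset_rfl, fun h => absurd h hv, fun _ => rfl⟩
  choose N1 hN1 hN1a hN1b using htrim
  obtain ⟨ρ, hρ1, hρ2, hρ3⟩ := rootmap m (k1 k) N1 ℓ J i0 hi0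
    (fun v u hu => hℓ v u (hN1 v hu))
    (fun v v' u hu hv hv' => hp v v' u hu (hN1 _ hv) (hN1 _ hv'))
    (fun v hv => by
      rcases hN1a v hv with h | h
      · have := hN1 v
        rw [h, Finset.subset_empty] at this
        simp [this]
      · exact h.le)
  obtain ⟨rank, P, hP1, hP2⟩ := hda k V V ρ (fun v => if ℓ v + 1 ∈ J then ∅ else N v)
    (fun r => by convert hρ1 r)
    (fun v => by
      by_cases hv : ℓ v + 1 ∈ J
      · simp [hv]
      · simp only [hv, if_false]
        exact (hB v).imp id (fun h => by omega))
  let typ : V → Bool := fun v =>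
    decide (k1 k ≤ ((N v).filter (fun x => rank (ρ v) < rank x)).card)
  have hN0 : ∀ v, ∃ s ⊆ N1 v, (N v = ∅ ∨ k1 k ≤ s.card) ∧
      (ℓ v + 1 ∉ J → typ v = true → ∀ u ∈ s, rank (ρ v) < rank u) ∧
      (ℓ v + 1 ∉ J → typ v = false → ∀ u ∈ s, u ∈ P v ∧ rank u < rank (ρ v)) := by
    intro v
    by_cases hv : ℓ v + 1 ∈ J
    · exact ⟨N1 v, subset_rfl, (hN1a v hv).imp id (fun h => h.ge), fun h => absurd hv h,
        fun h => absurd hv h⟩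
    · have hP := hP1 v
      simp only [hv, if_false] at hP
      rcases hP with h | h | h
      · exact ⟨∅, by simp, Or.inl h, by simp, by simp⟩
      · refine ⟨(N v).filter (fun x => rank (ρ v) < rank x), ?_, Or.inr ?_, ?_, ?_⟩
        · rw [hN1b v hv]; exact Finset.filter_subset _ _
        · convert h
        · intro _ _ u hu
          exact (Finset.mem_filter.1 hu).2
        · intro _ ht
          exfalso
          simp only [typ, decide_eq_false_iff_not] at ht
          apply ht
          convert h
      · by_cases ht : typ v = true
        · have ht' := ht
          simp only [typ, decide_eq_true_eq] at ht'
          refine ⟨(N v).filter (fun x => rank (ρ v) < rank x), ?_, Or.inr ht', ?_, ?_⟩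
          · rw [hN1b v hv]; exact Finset.filter_subset _ _
          · intro _ _ u hu
            exact (Finset.mem_filter.1 hu).2
          · intro _ hf
            rw [ht] at hf
            simp at hf
        · refine ⟨P v, by rw [hN1b v hv]; exact h.1, Or.inr h.2.1.ge, ?_, ?_⟩
          · intro _ hf; exact absurd hf ht
          · intro _ _ u hu
            exact ⟨hu, h.2.2 u hu⟩
  choose N0 hN01 hN02 hN03 hN04 using hN0
  have hsub0 : SubA (k1 k) N N0 := fun v => ⟨(hN01 v).trans (hN1 v), hN02 v⟩
  let A : (ZMod (m + 1) → Bool) → V → Prop := fun t v => ℓ v + 1 ∈ J ∨ typ v = t (ℓ v)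
  obtain ⟨N', hN', hQ⟩ := seqLemma N0
    (fun t N => ∃ c : V → ZMod (m + 2) ⊕ κ, Good (restr (A t) N) (m + 1) c) g hg
    (by
      rintro t N N' hs ⟨c, hc⟩
      refine ⟨c, hc.mono ?_⟩
      intro v u
      rw [mem_restr, mem_restr]
      exact fun h => ⟨h.1, hs v h.2⟩)
    (by
      intro t k hk N2 hN2 hB2
      have hB3 : Big (g k) (restr (A t) N2) := restr_big _ hB2
      have hm : ∀ v u, u ∈ restr (A t) N2 v → u ∈ N v ∧ u ∈ N1 v ∧ u ∈ N0 v ∧ A t v := by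
        intro v u hu
        rw [mem_restr] at hu
        have h3 := hN2 v hu.2
        exact ⟨hN1 v (hN01 v h3), hN01 v h3, h3, hu.1⟩
      have hA : ∀ v u, u ∈ restr (A t) N2 v → ℓ u ∉ J → ℓ v + 1 ∉ J ∧ typ v = t (ℓ v) := by
        intro v u hu hJu
        obtain ⟨h1, h2, h3, h4⟩ := hm v u hu
        rw [hℓ v u h1] at hJu
        exact ⟨hJu, h4.resolve_left hJu⟩
      obtain ⟨N3, h3, c, hc⟩ := pattern_step hS (restr (A t) N2) ℓ J hJ hJs
        (fun v u hu => hℓ v u (hm v u hu).1)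
        (fun v v' u hu hv hv' => hp v v' u hu (hm v u hv).1 (hm v' u hv').1)
        (fun v => rank (ρ v)) t
        (fun v u hu hJu => by rw [hρ2 v u (hm v u hu).2.1 hJu])
        (fun v u hu hJu ht => by
          obtain ⟨h1, h2⟩ := hA v u hu hJu
          rw [hρ3 u hJu]
          exact hN03 v h1 (by rw [h2, ht]) u (hm v u hu).2.2.1)
        (fun v u hu hJu ht => by
          obtain ⟨h1, h2⟩ := hA v u hu hJu
          rw [hρ3 u hJu]
          exact (hN04 v h1 (by rw [h2, ht]) u (hm v u hu).2.2.1).2)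
        (fun v v' u hJu ht ht' hu hu' => by
          obtain ⟨h1, h2⟩ := hA v u hu hJu
          obtain ⟨h1', h2'⟩ := hA v' u hu' hJu
          exact hP2 v v' u (hN04 v h1 (by rw [h2, ht]) u (hm v u hu).2.2.1).1
            (hN04 v' h1' (by rw [h2', ht']) u (hm v' u hu').2.2.1).1)
        k hk hB3
      obtain ⟨N4, h4, h5⟩ := restr_step (A t) (hB2.mono (by
        simp only [g]
        nlinarith)) h3
      exact ⟨N4, h4, c, hc.mono h5⟩)
    L k hk N0 (fun v => subset_rfl) hsub0.big
  refine ⟨N', hsub0.trans hk1p hN', ?_⟩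
  have hQ' : ∀ t, ∃ c : V → ZMod (m + 2) ⊕ κ, Good (restr (A t) N') (m + 1) c :=
    fun t => hQ t (by simp [L])
  choose c hc using hQ'
  refine ⟨fun v t => c t v, ?_⟩
  intro x hx he
  have hlev : ∀ i ≤ m + 1, ℓ (x i) = ℓ (x 0) + (i : ℕ) := by
    intro i
    induction i with
    | zero => simp
    | succ i ih =>
      intro hi
      rw [hℓ _ _ ((hsub0.trans hk1p hN' _).1 (hx i (by omega))), ih (by omega)]
      push_cast
      ring
  let t : ZMod (m + 1) → Bool := fun j => typ (x ((j - ℓ (x 0)).val))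
  apply hc t x
  · intro i hi
    rw [mem_restr]
    refine ⟨Or.inr ?_, hx i hi⟩
    simp only [t]
    rw [hlev i hi.le, add_sub_cancel_left, ZMod.val_natCast_of_lt hi]
  · exact congrFun he t

lemma S_all (m s : ℕ) : SProp m s := by
  induction s with
  | zero =>
    refine ⟨Unit, inferInstance, fun _ => 0, ?_⟩
    intro k hk V _ N ℓ J hJ hJs
    exfalso
    apply hJ
    rw [Finset.card_eq_zero] at hJs
    simpa using hJs
  | succ s ih => exact S_step m s ih

lemma T_all (m : ℕ) : ∃ (κ : Type) (_ : Fintype κ) (ds : ℕ → ℕ), ∀ k, 1 ≤ k →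
    ∀ (V : Type) [Fintype V] (N : V → Finset V), Big (ds k) N →
    ∃ N', SubA k N N' ∧ ∃ c : V → κ, ∀ j, 1 ≤ j → j ≤ m → Good N' j c := by
  induction m with
  | zero =>
    refine ⟨Unit, inferInstance, fun k => k, ?_⟩
    intro k hk V _ N hB
    exact ⟨N, fun v => ⟨subset_rfl, hB v⟩, fun _ => (), fun j h1 h2 => by omega⟩
  | succ m ih =>
    obtain ⟨κ, hκ, dt, hT⟩ := ih
    obtain ⟨κs, hκs, ds, hS⟩ := S_all m (m + 1)
    let g : ℕ → ℕ := fun k => k + ds k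
    have hg : ∀ k, 1 ≤ k → 1 ≤ g k := by
      intro k hk; simp only [g]; omega
    let L : List (ZMod (m + 1) → κ) := (Finset.univ : Finset (ZMod (m + 1) → κ)).toList
    let k1 : ℕ → ℕ := fun k => g^[L.length] k
    have hk1 : ∀ k, 1 ≤ k → 1 ≤ k1 k := fun k hk => iterate_ge_one g hg _ k hk
    refine ⟨κ × ((ZMod (m + 1) → κ) → κs), inferInstance,
      fun k => dt (Fintype.card κ * k1 k + 1), ?_⟩
    intro k hk V _ N hB
    have hk1p := hk1 k hk
    obtain ⟨N1, hN1, c, hc⟩ := hT (Fintype.card κ * k1 k + 1) (by omega) V N hB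
    obtain ⟨N0, hN0, hhom⟩ := homog N1 c (k1 k) (hN1.big.mono (by omega))
    have hsub0 : SubA (k1 k) N N0 := hN1.trans (by omega) hN0
    let A : (ZMod (m + 1) → κ) → V → Prop := fun a v =>
      Function.Injective a ∧ ∃ i, c v = a i ∧ ∃ u ∈ N0 v, c u = a (i + 1)
    obtain ⟨N', hN', hQ⟩ := seqLemma N0
      (fun a N => ∃ c : V → κs, Good (restr (A a) N) (m + 1) c) g hg
      (by
        rintro t N N' hs ⟨c, hc⟩
        refine ⟨c, hc.mono ?_⟩
        intro v u
        rw [mem_restr, mem_restr]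
        exact fun h => ⟨h.1, hs v h.2⟩)
      (by
        intro a k hk N2 hN2 hB2
        have hB3 : Big (g k) (restr (A a) N2) := restr_big _ hB2
        let ℓ : V → ZMod (m + 1) := fun v => if h : ∃ i, c v = a i then h.choose else 0
        have hℓ : Function.Injective a → ∀ v i, c v = a i → ℓ v = i := by
          intro ha v i hi
          have h : ∃ i, c v = a i := ⟨i, hi⟩
          simp only [ℓ]
          rw [dif_pos h]
          apply ha
          rw [← h.choose_spec, hi]
        obtain ⟨N3, h3, c3, hc3⟩ := hS k hk V (restr (A a) N2) ℓ ∅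
          (fun h => by
            have := Finset.mem_univ (0 : ZMod (m + 1))
            rw [← h] at this
            simp at this)
          (by rw [Finset.compl_empty, Finset.card_univ, ZMod.card])
          (by
            intro v u hu
            rw [mem_restr] at hu
            obtain ⟨⟨ha, i, hi, u', hu', hu'2⟩, hu2⟩ := hu
            rw [hℓ ha v i hi, hℓ ha u (i + 1)]
            rw [hhom v u (hN2 v hu2) u' hu', hu'2])
          (by simp)
          (hB3.mono (by simp only [g]; omega))
        obtain ⟨N4, h4, h5⟩ := restr_step (A a) (hB2.mono (by
          simp only [g]
          omega)) h3
        exact ⟨N4, h4, c3, hc3.mono h5⟩)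
      L k hk N0 (fun v => subset_rfl) hsub0.big
    refine ⟨N', hsub0.trans hk1p hN', ?_⟩
    have hQ' : ∀ a, ∃ c : V → κs, Good (restr (A a) N') (m + 1) c :=
      fun t => hQ t (by simp [L])
    choose cs hcs using hQ'
    refine ⟨fun v => (c v, fun a => cs a v), ?_⟩
    have hN'1 : ∀ v, N' v ⊆ N1 v := fun v => (hN' v).1.trans (hN0 v).1
    intro j hj1 hj2
    by_cases hjm : j ≤ m
    · exact ((hc j hj1 hjm).mono hN'1).comp Prod.fst (fun v => rfl)
    · have hj : j = m + 1 := by omega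
      subst hj
      intro x hx he
      have he1 : c (x 0) = c (x (m + 1)) := congrArg Prod.fst he
      have he2 := congrArg Prod.snd he
      let a : ZMod (m + 1) → κ := fun i => c (x i.val)
      have hinj' : ∀ p q : ℕ, p < q → q ≤ m → c (x p) ≠ c (x q) := by
        intro p q hpq hq
        have := hc (q - p) (by omega) (by omega) (fun i => x (p + i))
          (fun i hi => hN'1 _ (by
            have := hx (p + i) (by omega)
            rwa [add_assoc] at this))
        simp only [add_zero] at this
        rwa [Nat.add_sub_cancel' hpq.le] at this
      have hinj : Function.Injective a := by
        intro p q hpq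
        simp only [a] at hpq
        have hp := ZMod.val_lt p
        have hq := ZMod.val_lt q
        rcases lt_trichotomy p.val q.val with h | h | h
        · exact absurd hpq (hinj' _ _ h (by omega))
        · exact ZMod.val_injective _ h
        · exact absurd hpq.symm (hinj' _ _ h (by omega))
      apply hcs a x
      · intro i hi
        rw [mem_restr]
        refine ⟨⟨hinj, (i : ZMod (m + 1)), ?_, x (i + 1), (hN' _).1 (hx i hi), ?_⟩, hx i hi⟩
        · simp only [a]
          rw [ZMod.val_natCast_of_lt hi]
        · simp only [a]
          by_cases him : i = m
          · subst him
            have h0 : ((i : ℕ) : ZMod (i + 1)) + 1 = 0 := by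
              have := ZMod.natCast_self (i + 1)
              push_cast at this
              exact this
            rw [h0, ZMod.val_zero, he1]
          · have : ((i : ℕ) : ZMod (m + 1)) + 1 = ((i + 1 : ℕ) : ZMod (m + 1)) := by
              push_cast; rfl
            rw [this, ZMod.val_natCast_of_lt (by omega)]
      · exact congrFun he2 a

/-- Adjacency in the underlying undirected graph. -/
def UAdj {V : Type} (N : V → Finset V) (u v : V) : Prop := v ∈ N u ∨ u ∈ N v

lemma no_cycles_of_colouring {V κ : Type} (N : V → Finset V) (c : V → κ)
    (h1 : ∀ u v w, v ∈ N u → w ∈ N u → c v = c w)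
    (h2 : ∀ u a w x y, a ∈ N u → w ∈ N a → x ∈ N u → y ∈ N x → c w = c y)
    (g1 : ∀ u v, v ∈ N u → c u ≠ c v)
    (g3 : ∀ x0 x1 x2 x3, x1 ∈ N x0 → x2 ∈ N x1 → x3 ∈ N x2 → c x0 ≠ c x3)
    (g5 : ∀ x0 x1 x2 x3 x4 x5, x1 ∈ N x0 → x2 ∈ N x1 → x3 ∈ N x2 → x4 ∈ N x3 → x5 ∈ N x4 →
      c x0 ≠ c x5) :
    (∀ x0 x1 x2, UAdj N x0 x1 → UAdj N x1 x2 → UAdj N x2 x0 → False) ∧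
    (∀ x0 x1 x2 x3 x4, UAdj N x0 x1 → UAdj N x1 x2 → UAdj N x2 x3 → UAdj N x3 x4 →
      UAdj N x4 x0 → False) := by
  constructor
  · intro x0 x1 x2 a0 a1 a2
    unfold UAdj at *
    rcases a0 with a0 | a0 <;> rcases a1 with a1 | a1 <;> rcases a2 with a2 | a2 <;> grind
  · intro x0 x1 x2 x3 x4 a0 a1 a2 a3 a4
    unfold UAdj at *
    rcases a0 with a0 | a0 <;> rcases a1 with a1 | a1 <;> rcases a2 with a2 | a2 <;>
      rcases a3 with a3 | a3 <;> rcases a4 with a4 | a4 <;> grind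

lemma finite_final (k : ℕ) (hk : 1 ≤ k) : ∃ d, 1 ≤ d ∧ ∀ (V : Type) [Fintype V]
    (N : V → Finset V), Big d N →
    ∃ N', SubA k N N' ∧
    (∀ x0 x1 x2, UAdj N' x0 x1 → UAdj N' x1 x2 → UAdj N' x2 x0 → False) ∧
    (∀ x0 x1 x2 x3 x4, UAdj N' x0 x1 → UAdj N' x1 x2 → UAdj N' x2 x3 → UAdj N' x3 x4 →
      UAdj N' x4 x0 → False) := by
  obtain ⟨κ, hκ, ds, hT⟩ := T_all 5
  let k2 := Fintype.card (Option κ) * k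
  have hk2 : 1 ≤ k2 := Nat.one_le_iff_ne_zero.2 (by
    have : 0 < Fintype.card (Option κ) := Fintype.card_pos
    simp only [k2]
    positivity)
  refine ⟨ds (Fintype.card κ * k2 + 1) + 1, by omega, ?_⟩
  intro V _ N hB
  obtain ⟨N1, hN1, c, hc⟩ := hT (Fintype.card κ * k2 + 1) (by omega) V N (hB.mono (by omega))
  obtain ⟨N2, hN2, hhom⟩ := homog N1 c k2 (hN1.big.mono (by omega))
  let F : V → Option κ := fun v => if h : (N2 v).Nonempty then some (c h.choose) else none
  have hF : ∀ u v, v ∈ N2 u → F u = some (c v) := by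
    intro u v hv
    have h : (N2 u).Nonempty := ⟨v, hv⟩
    simp only [F]
    rw [dif_pos h, hhom u _ h.choose_spec v hv]
  obtain ⟨N3, hN3, hhom3⟩ := homog N2 F k hN2.big
  have s1 : ∀ v, N3 v ⊆ N2 v := fun v => (hN3 v).1
  have s2 : ∀ v, N3 v ⊆ N1 v := fun v => (s1 v).trans (hN2 v).1
  refine ⟨N3, hN1.trans (by omega) (hN2.trans hk2 hN3), ?_⟩
  apply no_cycles_of_colouring N3 c
  · intro u v w hv hw
    exact hhom u v (s1 u hv) w (s1 u hw)
  · intro u a w x y ha hw hx hy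
    have e1 := hhom3 u a ha x hx
    rw [hF a w (s1 a hw), hF x y (s1 x hy)] at e1
    exact Option.some_injective _ e1
  · intro u v hv
    have := hc 1 (by omega) (by omega) (fun i => if i = 0 then u else v) (by
      intro i hi
      interval_cases i
      simpa using s2 _ hv)
    simpa using this
  · intro x0 x1 x2 x3 h1 h2 h3
    have := hc 3 (by omega) (by omega)
      (fun i => if i = 0 then x0 else if i = 1 then x1 else if i = 2 then x2 else x3) (by
      intro i hi
      interval_cases i
      · simpa using s2 _ h1
      · simpa using s2 _ h2
      · simpa using s2 _ h3)
    simpa using this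
  · intro x0 x1 x2 x3 x4 x5 h1 h2 h3 h4 h5
    have := hc 5 (by omega) (by omega)
      (fun i => if i = 0 then x0 else if i = 1 then x1 else if i = 2 then x2 else
        if i = 3 then x3 else if i = 4 then x4 else x5) (by
      intro i hi
      interval_cases i
      · simpa using s2 _ h1
      · simpa using s2 _ h2
      · simpa using s2 _ h3
      · simpa using s2 _ h4
      · simpa using s2 _ h5)
    simpa using this

lemma infinite_final (k : ℕ) (hk : 1 ≤ k) : ∃ d, 1 ≤ d ∧ ∀ (V : Type)
    (N : V → Finset V), Big d N →
    ∃ N', SubA k N N' ∧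
    (∀ x0 x1 x2, UAdj N' x0 x1 → UAdj N' x1 x2 → UAdj N' x2 x0 → False) ∧
    (∀ x0 x1 x2 x3 x4, UAdj N' x0 x1 → UAdj N' x1 x2 → UAdj N' x2 x3 → UAdj N' x3 x4 →
      UAdj N' x4 x0 → False) := by
  obtain ⟨d, hd1, hd⟩ := finite_final k hk
  refine ⟨d, hd1, ?_⟩
  intro V N hB
  have hfin : ∀ S : Finset V, ∃ NS : V → Finset V, (∀ v, NS v ⊆ N v) ∧
      (∀ v ∈ S, N v = ∅ ∨ k ≤ (NS v).card) ∧
      (∀ x0 x1 x2, UAdj NS x0 x1 → UAdj NS x1 x2 → UAdj NS x2 x0 → False) ∧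
      (∀ x0 x1 x2 x3 x4, UAdj NS x0 x1 → UAdj NS x1 x2 → UAdj NS x2 x3 → UAdj NS x3 x4 →
        UAdj NS x4 x0 → False) := by
    intro S
    let W : Finset V := S ∪ S.biUnion N
    let NW : W → Finset W := fun v => if v.1 ∈ S then (N v.1).subtype (fun x => x ∈ W) else ∅
    have hcard : ∀ v : W, v.1 ∈ S → (NW v).card = (N v.1).card := by
      intro v hv
      simp only [NW, hv, if_true]
      rw [Finset.card_subtype, Finset.filter_true_of_mem]
      intro x hx
      exact Finset.mem_union_right _ (Finset.mem_biUnion.2 ⟨v.1, hv, hx⟩)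
    obtain ⟨M, hM, hM3, hM5⟩ := hd W NW (by
      intro v
      by_cases hv : v.1 ∈ S
      · rw [hcard v hv]
        rcases hB v.1 with h | h
        · left
          rw [← Finset.card_eq_zero, hcard v hv, h]
          rfl
        · exact Or.inr h
      · left
        simp [NW, hv])
    have hNW : ∀ v u : W, u ∈ NW v → u.1 ∈ N v.1 := by
      intro v u hu
      simp only [NW] at hu
      split_ifs at hu
      · simpa using hu
      · simp at hu
    let NS : V → Finset V := fun v =>
      if h : v ∈ W then (M ⟨v, h⟩).map (Function.Embedding.subtype _) else ∅
    have hNS : ∀ v u, u ∈ NS v → ∃ (hv : v ∈ W) (hu : u ∈ W), (⟨u, hu⟩ : W) ∈ M ⟨v, hv⟩ := by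
      intro v u hu
      simp only [NS] at hu
      split_ifs at hu with h
      · rw [Finset.mem_map] at hu
        obtain ⟨⟨y, hy⟩, hy1, rfl⟩ := hu
        exact ⟨h, hy, hy1⟩
      · simp at hu
    have hU : ∀ u v, UAdj NS u v → ∃ (hu : u ∈ W) (hv : v ∈ W), UAdj M ⟨u, hu⟩ ⟨v, hv⟩ := by
      rintro u v (h | h)
      · obtain ⟨a, b, h⟩ := hNS _ _ h
        exact ⟨a, b, Or.inl h⟩
      · obtain ⟨a, b, h⟩ := hNS _ _ h
        exact ⟨b, a, Or.inr h⟩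
    refine ⟨NS, ?_, ?_, ?_, ?_⟩
    · intro v u hu
      obtain ⟨a, b, h⟩ := hNS _ _ hu
      exact hNW _ _ ((hM _).1 h)
    · intro v hv
      have hvW : v ∈ W := Finset.mem_union_left _ hv
      have e1 : (NS v).card = (M ⟨v, hvW⟩).card := by
        simp only [NS]
        rw [dif_pos hvW, Finset.card_map]
      rw [e1]
      rcases (hM ⟨v, hvW⟩).2 with h | h
      · left
        have := hcard ⟨v, hvW⟩ hv
        rw [h] at this
        exact Finset.card_eq_zero.1 this.symm
      · exact Or.inr h
    · intro x0 x1 x2 a0 a1 a2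
      obtain ⟨_, _, h0⟩ := hU _ _ a0
      obtain ⟨_, _, h1⟩ := hU _ _ a1
      obtain ⟨_, _, h2⟩ := hU _ _ a2
      exact hM3 _ _ _ h0 h1 h2
    · intro x0 x1 x2 x3 x4 a0 a1 a2 a3 a4
      obtain ⟨_, _, h0⟩ := hU _ _ a0
      obtain ⟨_, _, h1⟩ := hU _ _ a1
      obtain ⟨_, _, h2⟩ := hU _ _ a2
      obtain ⟨_, _, h3⟩ := hU _ _ a3
      obtain ⟨_, _, h4⟩ := hU _ _ a4
      exact hM5 _ _ _ _ _ h0 h1 h2 h3 h4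
  choose NS hS1 hS2 hS3 hS5 using hfin
  obtain ⟨χ, hχ⟩ := Finset.rado_selection (β := fun v => {s // s ∈ (N v).powerset})
    (fun S v => ⟨NS S v, Finset.mem_powerset.2 (hS1 S v)⟩)
  have hχ' : ∀ s : Finset V, ∃ t, s ⊆ t ∧ ∀ x ∈ s, (χ x).1 = NS t x := by
    intro s
    obtain ⟨t, ht, h⟩ := hχ s
    exact ⟨t, ht, fun x hx => by rw [h x hx]⟩
  have hU : ∀ (s t : Finset V), (∀ x ∈ s, (χ x).1 = NS t x) → ∀ u ∈ s, ∀ v ∈ s,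
      UAdj (fun v => (χ v).1) u v → UAdj (NS t) u v := by
    intro s t h u hu v hv
    unfold UAdj
    beta_reduce
    rw [h u hu, h v hv]
    exact id
  refine ⟨fun v => (χ v).1, ?_, ?_, ?_⟩
  · intro v
    refine ⟨Finset.mem_powerset.1 (χ v).2, ?_⟩
    obtain ⟨t, ht, h⟩ := hχ' {v}
    beta_reduce
    rw [h v (by simp)]
    exact hS2 t v (ht (by simp))
  · intro x0 x1 x2 a0 a1 a2
    obtain ⟨t, ht, h⟩ := hχ' {x0, x1, x2}
    exact hS3 t x0 x1 x2 (hU _ t h _ (by simp) _ (by simp) a0)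
      (hU _ t h _ (by simp) _ (by simp) a1) (hU _ t h _ (by simp) _ (by simp) a2)
  · intro x0 x1 x2 x3 x4 a0 a1 a2 a3 a4
    obtain ⟨t, ht, h⟩ := hχ' {x0, x1, x2, x3, x4}
    exact hS5 t x0 x1 x2 x3 x4 (hU _ t h _ (by simp) _ (by simp) a0)
      (hU _ t h _ (by simp) _ (by simp) a1) (hU _ t h _ (by simp) _ (by simp) a2)
      (hU _ t h _ (by simp) _ (by simp) a3) (hU _ t h _ (by simp) _ (by simp) a4)

end OutAssignments

/-- For every `k` there is `d` such that every digraph of minimum out-degree at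
least `d` contains a subdigraph of minimum out-degree at least `k` containing
no orientation of `C₃` and no orientation of `C₅`; in particular every
orientation of `C₃` and of `C₅` is avoidable. -/
theorem orientations_of_C3_and_C5_are_avoidable :
    ∀ k : ℕ, ∃ d : ℕ, ∀ (α : Type) (D : Digraph' α), D.verts.Nonempty →
      D.MinOutDegAtLeast d →
      ∃ D' : Digraph' α, D'.IsSubdigraph D ∧ D'.verts.Nonempty ∧
        D'.MinOutDegAtLeast k ∧
        (∀ F : Digraph' (Fin 3), IsCycleOrientation F → ¬ D'.HasCopy F) ∧
        (∀ F : Digraph' (Fin 5), IsCycleOrientation F → ¬ D'.HasCopy F) := by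
  intro k
  obtain ⟨d, hd1, hd⟩ := infinite_final (k + 1) (by omega)
  refine ⟨d, ?_⟩
  intro α D hne hD
  classical
  have hch : ∀ v, ∃ s : Finset α, (∀ u ∈ s, D.Adj v u) ∧ (v ∈ D.verts → d ≤ s.card) ∧
      (v ∉ D.verts → s = ∅) := by
    intro v
    by_cases hv : v ∈ D.verts
    · obtain ⟨s, hs, hs2⟩ := hD v hv
      exact ⟨s, fun u hu => hs hu, fun _ => hs2, fun h => absurd hv h⟩
    · exact ⟨∅, by simp, fun h => absurd h hv, fun _ => rfl⟩
  choose N hN1 hN2 hN3 using hch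
  obtain ⟨N', hs, h3, h5⟩ := hd α N (fun v => by
    by_cases hv : v ∈ D.verts
    · exact Or.inr (hN2 v hv)
    · exact Or.inl (hN3 v hv))
  have hadj : ∀ u v, v ∈ N' u → D.Adj u v := fun u v h => hN1 u v ((hs u).1 h)
  let D' : Digraph' α :=
    { verts := D.verts
      Adj := fun u v => v ∈ N' u
      ne_of_adj := fun u v h => D.ne_of_adj (hadj u v h)
      mem_verts_left := fun u v h => D.mem_verts_left (hadj u v h)
      mem_verts_right := fun u v h => D.mem_verts_right (hadj u v h) }
  have hF : ∀ {n : ℕ} [NeZero n] (F : Digraph' (Fin n)) (f : Fin n → α), IsCycleOrientation F →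
      (∀ ⦃u v : Fin n⦄, F.Adj u v → D'.Adj (f u) (f v)) → ∀ i, UAdj N' (f i) (f (i + 1)) := by
    intro n _ F f hF hf i
    rcases hF.2.2 i with h | h
    · exact Or.inl (hf h.1)
    · exact Or.inr (hf h.1)
  refine ⟨D', ⟨subset_rfl, fun u v h => hadj u v h⟩, hne, ?_, ?_, ?_⟩
  · intro v hv
    refine ⟨N' v, fun u hu => hu, ?_⟩
    rcases (hs v).2 with h | h
    · have := hN2 v hv
      rw [h] at this
      simp at this
      omega
    · omega
  · rintro F hFo ⟨f, _, _, hf⟩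
    have := hF F f hFo hf
    exact h3 _ _ _ (this 0) (this 1) (this 2)
  · rintro F hFo ⟨f, _, _, hf⟩
    have := hF F f hFo hf
    exact h5 _ _ _ _ _ (this 0) (this 1) (this 2) (this 3) (this 4)
end

section
/- There exists a polynomially bounded function f : ℕ → ℕ such that every digraph of minimum out-degree at least f(k) contains a subdigraph of minimum out-degree at least k whose underlying undirected graph has odd-girth at least 7 (i.e., contains no cycle of length 3 or 5). -/
open Digraph'

/-- The underlying undirected graph of `D` contains a cycle of length `n`. -/
def HasUCycle {α : Type} (D : Digraph' α) (n : ℕ) : Prop :=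
  3 ≤ n ∧ ∃ f : ℕ → α, (∀ i j, i < n → j < n → f i = f j → i = j) ∧
    (∀ i, i < n → f i ∈ D.verts) ∧
    ∀ i, i < n → (D.Adj (f i) (f ((i + 1) % n)) ∨ D.Adj (f ((i + 1) % n)) (f i))

open Finset in
open Classical in
lemma fiber_count {V Ω : Type} [Fintype V] [DecidableEq V] [Fintype Ω] [Nonempty Ω]
    (w : V) (B : Finset (V → Ω)) (hB : ∀ σ ω, σ ∈ B → Function.update σ w ω ∈ B)
    (A : (V → Ω) → Prop) (P K : ℕ)
    (hA : ∀ σ ∈ B, P * #{ω | A (Function.update σ w ω)} ≤ K * Fintype.card Ω) :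
    P * #(B.filter A) ≤ K * #B := by
  have key : #(B.filter A) * Fintype.card Ω ≤ ∑ σ ∈ B, #{ω | A (Function.update σ w ω)} := by
    rw [← Finset.card_sigma, ← Finset.card_univ, ← Finset.card_product]
    apply Finset.card_le_card_of_injOn (fun p => ⟨Function.update p.1 w p.2, p.1 w⟩)
    · rintro ⟨τ, ω⟩ h
      simp only [coe_product, coe_filter, coe_univ, Set.mem_prod, Set.mem_ofPred_eq,
        Set.mem_univ, and_true] at h
      simp only [coe_sigma, Set.mem_sigma_iff, mem_coe, mem_filter, mem_univ, true_and]
      refine ⟨hB _ _ h.1, ?_⟩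
      simpa using h.2
    · rintro ⟨τ, ω⟩ h ⟨τ', ω'⟩ h' heq
      simp only [Sigma.mk.injEq, heq_eq_eq] at heq
      obtain ⟨h1, h2⟩ := heq
      have h3 : ω = ω' := by
        have := congrFun h1 w
        simpa using this
      subst h3
      have : τ = τ' := by
        funext y
        by_cases hy : y = w
        · subst hy; exact h2
        · have := congrFun h1 y
          simpa [hy] using this
      rw [this]
  have h2 : P * ∑ σ ∈ B, #{ω | A (Function.update σ w ω)} ≤ #B * (K * Fintype.card Ω) := by
    rw [Finset.mul_sum, ← smul_eq_mul, ← Finset.sum_const]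
    exact Finset.sum_le_sum hA
  have hpos : 0 < Fintype.card Ω := Fintype.card_pos
  have : (P * #(B.filter A)) * Fintype.card Ω ≤ (K * #B) * Fintype.card Ω := by
    calc _ = P * (#(B.filter A) * Fintype.card Ω) := by ring
      _ ≤ _ := (Nat.mul_le_mul_left P key).trans h2
      _ = _ := by ring
  exact Nat.le_of_mul_le_mul_right this hpos

open Finset in
open Classical in
/-- A counting form of the local lemma. -/
lemma local_lemma {V Ω ι : Type} [Fintype V] [DecidableEq V] [Fintype Ω] [Nonempty Ω] [Fintype ι]
    (A : ι → (V → Ω) → Prop) (vbl : ι → Finset V) (s Δ P : ℕ) (hs1 : 1 ≤ s) (hP1 : 1 ≤ P)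
    (hs : ∀ i, #(vbl i) ≤ s) (hne : ∀ i, (vbl i).Nonempty)
    (hΔ : ∀ v, #{i | v ∈ vbl i} ≤ Δ)
    (hdep : ∀ i σ τ, (∀ v ∈ vbl i, σ v = τ v) → A i σ → A i τ)
    (hP : ∀ i (B : Finset (V → Ω)),
      (∀ σ τ, (∀ v, v ∉ vbl i → σ v = τ v) → σ ∈ B → τ ∈ B) →
      P * #(B.filter (A i)) ≤ #B)
    (h : 4 * Δ * s ≤ P) : ∃ σ, ∀ i, ¬ A i σ := by
  set G : Finset V → Finset (V → Ω) := fun X => {σ | ∀ i, vbl i ⊆ X → ¬ A i σ} with hG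
  set ε : ℝ := 1 / (2 * s) with hε
  have hs0 : (0 : ℝ) < s := by exact_mod_cast hs1
  have hP0 : (0 : ℝ) < P := by exact_mod_cast hP1
  have hε0 : 0 < ε := by positivity
  have hε1 : ε ≤ 1 / 2 := by
    rw [hε]
    apply one_div_le_one_div_of_le (by norm_num)
    have : (1 : ℝ) ≤ s := by exact_mod_cast hs1
    linarith
  -- iterating
  have iter : ∀ n : ℕ, (∀ X : Finset V, #X < n → ∀ v, v ∉ X →
      (1 - ε) * (#(G X) : ℝ) ≤ #(G (insert v X))) →
      ∀ Z Y : Finset V, Disjoint Y Z → #(Y ∪ Z) ≤ n →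
      (1 - ε) ^ #Z * (#(G Y) : ℝ) ≤ #(G (Y ∪ Z)) := by
    intro n hn Z
    induction Z using Finset.induction_on with
    | empty => intro Y _ _; simp
    | insert z Z hz ih =>
      intro Y hd hc
      rw [Finset.disjoint_insert_right] at hd
      have e : Y ∪ insert z Z = insert z (Y ∪ Z) := by
        ext; simp only [mem_union, mem_insert]; tauto
      have hz' : z ∉ Y ∪ Z := by simp [hd.1, hz]
      rw [e] at hc ⊢
      rw [Finset.card_insert_of_notMem hz'] at hc
      have h1 := ih Y hd.2 (by omega)
      have h2 := hn (Y ∪ Z) (by omega) z hz'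
      rw [Finset.card_insert_of_notMem hz, pow_succ]
      nlinarith
  have main : ∀ n : ℕ, ∀ X : Finset V, #X < n → ∀ v, v ∉ X →
      (1 - ε) * (#(G X) : ℝ) ≤ #(G (insert v X)) := by
    intro n
    induction n with
    | zero => intro X hX; omega
    | succ n ih =>
      intro X hX v hv
      have hsub : G X ⊆ G (insert v X) ∪
          ({i | v ∈ vbl i} : Finset ι).biUnion (fun i => (G (X \ vbl i)).filter (A i)) := by
        intro σ hσ
        by_contra hcon
        simp only [mem_union, mem_biUnion, not_or, not_exists, not_and, mem_filter, mem_univ,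
          true_and, hG] at hcon hσ
        obtain ⟨h1, h2⟩ := hcon
        apply h1
        intro i hi hA
        by_cases hvi : v ∈ vbl i
        · refine h2 i hvi ?_ hA
          intro j hj
          exact hσ j (hj.trans sdiff_subset)
        · exact hσ i ((Finset.subset_insert_iff_of_notMem hvi).1 hi) hA
      have hbound : ∀ i, ((#((G (X \ vbl i)).filter (A i)) : ℕ) : ℝ) ≤ 2 / P * #(G X) := by
        intro i
        have h1 := hP i (G (X \ vbl i)) (by
          intro σ τ hστ hσ
          simp only [hG, mem_filter, mem_univ, true_and] at hσ ⊢
          intro j hj hAj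
          refine hσ j hj (hdep j τ σ ?_ hAj)
          intro u hu
          exact (hστ u (Finset.mem_sdiff.1 (hj hu)).2).symm)
        have h2 := iter n ih (X ∩ vbl i) (X \ vbl i) (Finset.disjoint_sdiff_inter X (vbl i))
          (by rw [Finset.sdiff_union_inter]; omega)
        rw [Finset.sdiff_union_inter] at h2
        have h3 : (1 / 2 : ℝ) ≤ (1 - ε) ^ #(X ∩ vbl i) := by
          have hc : #(X ∩ vbl i) ≤ s := (card_le_card inter_subset_right).trans (hs i)
          have hb := one_add_mul_le_pow (a := -ε) (by linarith) (#(X ∩ vbl i))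
          have hc' : (#(X ∩ vbl i) : ℝ) ≤ s := by exact_mod_cast hc
          have : (#(X ∩ vbl i) : ℝ) * ε ≤ s * ε := by gcongr
          have e : (s : ℝ) * ε = 1 / 2 := by rw [hε]; field_simp
          rw [show (1 : ℝ) - ε = 1 + -ε by ring]
          nlinarith
        have h4 : (1 / 2 : ℝ) * #(G (X \ vbl i)) ≤ #(G X) :=
          le_trans (by gcongr) h2
        have h5 : (P : ℝ) * #((G (X \ vbl i)).filter (A i)) ≤ #(G (X \ vbl i)) := by
          exact_mod_cast h1
        rw [div_mul_eq_mul_div, le_div_iff₀ hP0]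
        linarith
      have hcard : (#(G X) : ℝ) ≤ #(G (insert v X)) + Δ * (2 / P * #(G X)) := by
        have h1 : #(G X) ≤ #(G (insert v X)) +
            ∑ i ∈ ({i | v ∈ vbl i} : Finset ι), #((G (X \ vbl i)).filter (A i)) :=
          (card_le_card hsub).trans ((card_union_le _ _).trans
            (Nat.add_le_add_left card_biUnion_le _))
        have h2 : ((∑ i ∈ ({i | v ∈ vbl i} : Finset ι),
            #((G (X \ vbl i)).filter (A i)) : ℕ) : ℝ) ≤ Δ * (2 / P * #(G X)) := by
          push_cast
          refine (Finset.sum_le_card_nsmul _ _ _ (fun i _ => hbound i)).trans ?_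
          rw [nsmul_eq_mul]
          have : (#({i | v ∈ vbl i} : Finset ι) : ℝ) ≤ Δ := by exact_mod_cast hΔ v
          gcongr
        have h3 : (#(G X) : ℝ) ≤ #(G (insert v X)) +
            ((∑ i ∈ ({i | v ∈ vbl i} : Finset ι), #((G (X \ vbl i)).filter (A i)) : ℕ) : ℝ) := by
          exact_mod_cast h1
        linarith
      have hε2 : (Δ : ℝ) * (2 / P) ≤ ε := by
        rw [hε, mul_div_assoc', div_le_div_iff₀ hP0 (by positivity)]
        have : (4 * Δ * s : ℝ) ≤ P := by exact_mod_cast h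
        linarith
      have : (0 : ℝ) ≤ #(G X) := by positivity
      nlinarith
  have fin := iter _ (main (Fintype.card V)) univ ∅ (disjoint_empty_left _)
    (by simp)
  have hpos : 0 < #(G (∅ ∪ univ)) := by
    have hG0 : G ∅ = univ := by
      ext σ
      simp only [hG, mem_filter, mem_univ, true_and, iff_true, subset_empty]
      intro i hi
      exact absurd hi (hne i).ne_empty
    have : (0 : ℝ) < (1 - ε) ^ #(univ : Finset V) * (#(G ∅) : ℝ) := by
      have : (0 : ℝ) < 1 - ε := by linarith
      have h2 : 0 < #(G ∅) := by rw [hG0]; exact Finset.card_pos.2 Finset.univ_nonempty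
      positivity
    exact_mod_cast this.trans_le fin
  obtain ⟨σ, hσ⟩ := Finset.card_pos.1 hpos
  refine ⟨σ, fun i => ?_⟩
  simp only [hG, mem_filter, mem_univ, true_and] at hσ
  exact hσ i (by simp)

open Finset in
lemma trim_nbrs {V : Type} (N : V → Finset V) (act : Set V) (d : ℕ)
    (hN : ∀ v ∈ act, d ≤ #(N v)) :
    ∃ N' : V → Finset V, (∀ v, N' v ⊆ N v) ∧ (∀ v ∈ act, #(N' v) = d) ∧
      (∀ v, v ∉ act → N' v = ∅) := by
  classical
  have : ∀ v, ∃ t : Finset V, t ⊆ N v ∧ (v ∈ act → #t = d) ∧ (v ∉ act → t = ∅) := by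
    intro v
    by_cases hv : v ∈ act
    · obtain ⟨t, ht, htc⟩ := Finset.exists_subset_card_eq (hN v hv)
      exact ⟨t, ht, fun _ => htc, fun h => absurd hv h⟩
    · exact ⟨∅, by simp, fun h => absurd h hv, fun _ => rfl⟩
  choose N' h1 h2 h3 using this
  exact ⟨N', h1, h2, h3⟩

open Finset in
lemma exists_embeddings {V : Type} (N : V → Finset V) (act : Set V) (k q : ℕ)
    (hN : ∀ v ∈ act, #(N v) = k * q) :
    ∃ e : V → Fin k × Fin q → V, ∀ v ∈ act, Function.Injective (e v) ∧ ∀ p, e v p ∈ N v := by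
  classical
  have : ∀ v, ∃ e : Fin k × Fin q → V, v ∈ act → (Function.Injective e ∧ ∀ p, e p ∈ N v) := by
    intro v
    by_cases hv : v ∈ act
    · have hc : Fintype.card (Fin k × Fin q) = Fintype.card (N v) := by
        simp [hN v hv]
      have eq := Fintype.equivOfCardEq hc
      refine ⟨fun p => (eq p).1, fun _ => ⟨?_, fun p => (eq p).2⟩⟩
      intro a b hab
      exact eq.injective (Subtype.ext hab)
    · exact ⟨fun _ => v, fun h => absurd h hv⟩
  choose e he using this
  exact ⟨e, he⟩

open Finset in
open Classical in
lemma sel_prob {V : Type} {k q : ℕ} [Nonempty (Fin q)] (E : Fin k × Fin q → V)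
    (hE : Function.Injective E) (u : V) :
    q * #{ω : Fin k → Fin q | ∃ g, E (g, ω g) = u} ≤ Fintype.card (Fin k → Fin q) := by
  by_cases h : ∃ g i, E (g, i) = u
  · obtain ⟨g, i, rfl⟩ := h
    have := fiber_count (V := Fin k) (Ω := Fin q) g univ (by simp)
      (fun ω => ∃ g', E (g', ω g') = E (g, i)) q 1 (by
        intro σ _
        rw [one_mul, Fintype.card_fin]
        conv_rhs => rw [← mul_one q]
        gcongr
        rw [Finset.card_le_one]
        intro a ha b hb
        simp only [mem_filter, mem_univ, true_and] at ha hb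
        obtain ⟨g1, h1⟩ := ha
        obtain ⟨g2, h2⟩ := hb
        have h1 := hE h1
        have h2 := hE h2
        simp only [Prod.mk.injEq] at h1 h2
        obtain ⟨rfl, h1⟩ := h1
        obtain ⟨rfl, h2⟩ := h2
        simp at h1 h2
        rw [h1, h2])
    rw [one_mul, card_univ] at this
    convert this
  · push Not at h
    have : ({ω : Fin k → Fin q | ∃ g, E (g, ω g) = u} : Finset _) = ∅ := by
      ext ω; simp; intro g; exact h g _
    rw [this]; simp

open Finset in
open Classical in
open Fin.NatCast Fin.CommRing in
lemma cycle_count {V : Type} [Fintype V] (N : V → Finset V) (d m : ℕ)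
    (hN : ∀ v, #(N v) ≤ d) (y : V) :
    #{f : Fin (m+1) → V | (∀ i, f (i+1) ∈ N (f i)) ∧ ∃ j, f j = y} ≤ (m+1) * d^m := by
  have h1 : ({f : Fin (m+1) → V | (∀ i, f (i+1) ∈ N (f i)) ∧ ∃ j, f j = y} : Finset _) ⊆
      univ.biUnion (fun j : Fin (m+1) => {f : Fin (m+1) → V | (∀ i, f (i+1) ∈ N (f i)) ∧ f j = y}) := by
    intro f; simp
  refine (card_le_card h1).trans ?_
  refine (card_biUnion_le_card_mul _ _ (d^m) ?_).trans (by simp)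
  intro j _
  let r : V → V → ℕ := fun v u => (N v).toList.idxOf u
  have hr1 : ∀ v, ∀ u ∈ N v, r v u < d := by
    intro v u hu
    refine lt_of_lt_of_le (List.idxOf_lt_length_of_mem (by simpa using hu)) ?_
    simpa using hN v
  have hr2 : ∀ v, ∀ u ∈ N v, ∀ u' ∈ N v, r v u = r v u' → u = u' := by
    intro v u hu u' hu' h
    exact (List.idxOf_inj (by simpa using hu)).1 h
  have hc : #(Fintype.piFinset (fun _ : Fin m => range d)) = d^m := by simp
  rw [← hc]
  apply card_le_card_of_injOn (fun f (i : Fin m) => r (f (j + ((i:ℕ) : Fin (m+1)))) (f (j + ((i:ℕ) : Fin (m+1)) + 1)))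
  · intro f hf
    simp only [coe_filter, mem_univ, true_and, Set.mem_ofPred_eq] at hf
    simp only [mem_coe, Fintype.mem_piFinset, mem_range]
    intro i
    exact hr1 _ _ (hf.1 _)
  · intro f hf f' hf' heq
    simp only [coe_filter, mem_univ, true_and, Set.mem_ofPred_eq] at hf hf'
    have key : ∀ n : ℕ, n ≤ m → f (j + (n : Fin (m+1))) = f' (j + (n : Fin (m+1))) := by
      intro n
      induction n with
      | zero => intro _; simp [hf.2, hf'.2]
      | succ n ih =>
        intro hn
        have ih := ih (by omega)
        have := congrFun heq ⟨n, by omega⟩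
        simp only at this
        rw [← ih] at this
        have h3 := hr2 _ _ (hf.1 _) _ (by rw [ih]; exact hf'.1 _) this
        push_cast
        rw [← add_assoc]; exact h3
    funext i
    have := key (i - j).val (by have := (i-j).isLt; omega)
    simpa using this

/-- Destroying all directed cycles of a fixed length. -/
lemma stage_directed {V : Type} [Fintype V] (N : V → Finset V) (act : Set V) (m k q : ℕ)
    (hm : m ≤ 4) (hq : 100 * k ^ m ≤ q) (hk : 1 ≤ k)
    (hN : ∀ v ∈ act, k * q ≤ (N v).card) :
    ∃ S : V → Finset V, (∀ v, S v ⊆ N v) ∧ (∀ v ∈ act, k ≤ (S v).card) ∧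
      ∀ f : Fin (m+1) → V, Function.Injective f → ¬ ∀ i, f (i+1) ∈ S (f i) := by
  classical
  obtain ⟨N', hsub, hcard, hempty⟩ := trim_nbrs N act (k*q) hN
  obtain ⟨e, he⟩ := exists_embeddings N' act k q hcard
  have hk' : 1 ≤ k^m := Nat.one_le_pow _ _ hk
  have hq0 : 0 < q := by omega
  have : Nonempty (Fin q) := ⟨⟨0, hq0⟩⟩
  let ι := {f : Fin (m+1) → V // Function.Injective f ∧ (∀ i, f i ∈ act) ∧ ∀ i, f (i+1) ∈ N' (f i)}
  obtain ⟨σ, hσ⟩ := local_lemma (V := V) (Ω := Fin k → Fin q) (ι := ι)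
    (fun f σ => ∀ i, ∃ g, e (f.1 i) (g, σ (f.1 i) g) = f.1 (i+1))
    (fun f => Finset.univ.image f.1) (m+1) ((m+1) * (k*q)^m) (q^(m+1)) (by omega)
    (Nat.one_le_pow _ _ hq0) (fun f => Finset.card_image_le.trans (by simp))
    (fun f => ⟨f.1 0, by simp⟩) (by
      intro y
      have := cycle_count N' (k*q) m (by
        intro v
        by_cases hv : v ∈ act
        · exact (hcard v hv).le
        · simp [hempty v hv]) y
      refine le_trans ?_ this
      apply Finset.card_le_card_of_injOn (fun f => f.1)
      · intro f hf
        simp at hf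
        simp
        exact ⟨f.2.2.2, hf⟩
      · intro a _ b _ h
        exact Subtype.ext h) (by
      intro f σ τ h hA i
      obtain ⟨g, hg⟩ := hA i
      exact ⟨g, by rw [← h (f.1 i) (by simp)]; exact hg⟩) (by
      intro f B hB
      have : ∀ T : Finset (Fin (m+1)), q^T.card * (B.filter (fun σ : V → Fin k → Fin q => ∀ i ∈ T, ∃ g, e (f.1 i) (g, σ (f.1 i) g) = f.1 (i+1))).card ≤ B.card := by
        intro T
        induction T using Finset.induction_on with
        | empty => simp
        | insert j T hj ih =>
          have h1 := fiber_count (f.1 j) (B.filter (fun σ : V → Fin k → Fin q => ∀ i ∈ T, ∃ g, e (f.1 i) (g, σ (f.1 i) g) = f.1 (i+1))) (by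
            intro σ ω h
            rw [Finset.mem_filter] at h ⊢
            refine ⟨hB σ _ ?_ h.1, ?_⟩
            · intro v hv
              rw [Function.update_of_ne]
              rintro rfl
              simp at hv
            · intro i hi
              have : f.1 i ≠ f.1 j := fun h => hj (f.2.1 h ▸ hi)
              rw [Function.update_of_ne this]
              exact h.2 i hi) (fun σ => ∃ g, e (f.1 j) (g, σ (f.1 j) g) = f.1 (j+1)) q 1 (by
              intro σ _
              rw [one_mul]
              have := sel_prob (e (f.1 j)) (he _ (f.2.2.1 j)).1 (f.1 (j+1))
              simpa using this)
          rw [Finset.card_insert_of_notMem hj, pow_succ]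
          refine le_trans ?_ ih
          rw [mul_assoc]
          gcongr
          rw [one_mul] at h1
          refine le_trans ?_ h1
          gcongr
          intro σ hσ
          simp only [Finset.mem_filter, Finset.mem_insert, forall_eq_or_imp] at hσ ⊢
          tauto
      have := this Finset.univ
      rw [Finset.card_univ, Fintype.card_fin] at this
      simp only [Finset.mem_univ, true_implies] at this
      convert this) (by
      have h1 : 4 * ((m+1) * (k*q)^m) * (m+1) = (4*(m+1)*(m+1)) * k^m * q^m := by
        rw [mul_pow]; ring
      rw [h1, pow_succ, mul_comm (q^m) q]
      gcongr
      refine le_trans ?_ hq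
      gcongr
      nlinarith)
  refine ⟨fun v => if v ∈ act then Finset.univ.image (fun g => e v (g, σ v g)) else ∅, ?_, ?_, ?_⟩
  · intro v
    by_cases hv : v ∈ act
    · simp only [hv, if_true]
      refine Finset.Subset.trans ?_ (hsub v)
      intro u hu
      simp at hu
      obtain ⟨g, rfl⟩ := hu
      exact (he v hv).2 _
    · simp [hv]
  · intro v hv
    simp only [hv, if_true]
    rw [Finset.card_image_of_injective]
    · simp
    · intro a b hab
      have := (he v hv).1 hab
      simp at this
      exact this.1
  · intro f hf h
    have hact : ∀ i, f i ∈ act := by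
      intro i
      by_contra hi
      have := h i
      simp [hi] at this
    have h2 : ∀ i, ∃ g, e (f i) (g, σ (f i) g) = f (i+1) := by
      intro i
      have := h i
      simpa [hact i] using this
    refine hσ ⟨f, hf, hact, ?_⟩ h2
    intro i
    obtain ⟨g, hg⟩ := h2 i
    rw [← hg]
    exact (he _ (hact i)).2 _

open Classical in
lemma greedy {V β : Type} [Finite V] [Nonempty β] (x : V → ℝ) (Q : V → (V → β) → Prop)
    (hdep : ∀ w f f', f w = f' w → (∀ y, x w < x y → f y = f' y) → Q w f → Q w f')
    (hex : ∀ w (f : V → β), ∃ s, Q w (fun y => if y = w then s else f y)) :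
    ∃ f, ∀ w, Q w f := by
  classical
  let r : V → V → Prop := fun y w => x w < x y
  have : IsTrans V r := ⟨fun a b c h1 h2 => lt_trans h2 h1⟩
  have : Std.Irrefl r := ⟨fun a h => lt_irrefl _ h⟩
  have wf : WellFounded r := Finite.wellFounded_of_trans_of_irrefl r
  let F : ∀ w, (∀ y, r y w → β) → β := fun w rc =>
    Classical.choose (hex w (fun y => if h : r y w then rc y h else Classical.arbitrary β))
  refine ⟨wf.fix F, fun w => ?_⟩
  have h1 := Classical.choose_spec (hex w (fun y => if h : r y w then wf.fix F y else Classical.arbitrary β))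
  have h2 : wf.fix F w = Classical.choose (hex w (fun y => if h : r y w then wf.fix F y else Classical.arbitrary β)) := by
    rw [wf.fix_eq]
  refine hdep w _ _ ?_ ?_ h1
  · simp only [if_true]
    exact h2.symm
  · intro y hy
    have hne : y ≠ w := by rintro rfl; exact lt_irrefl _ hy
    have hr : r y w := hy
    simp [hne, hr]

open Finset in
open Classical in
lemma half_colour {V : Type} [Finite V] (N : V → Finset V) (x : V → ℝ) :
    ∃ c : V → Bool, ∀ w, #{u ∈ N w | x w < x u} ≤ 2 * #{u ∈ N w | x w < x u ∧ c u ≠ c w} := by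
  apply greedy x (fun w c => #{u ∈ N w | x w < x u} ≤ 2 * #{u ∈ N w | x w < x u ∧ c u ≠ c w})
  · intro w f f' h1 h2 h
    refine h.trans ?_
    gcongr 2 * #?_
    intro u
    simp only [mem_filter]
    rintro ⟨a, b, c⟩
    exact ⟨a, b, by rw [← h1, ← h2 u b]; exact c⟩
  · intro w f
    by_contra hcon
    push Not at hcon
    have ht := hcon true
    have hf := hcon false
    have hs : {u ∈ N w | x w < x u} ⊆ {u ∈ N w | x w < x u ∧ (if u = w then true else f u) ≠ true} ∪
      {u ∈ N w | x w < x u ∧ (if u = w then false else f u) ≠ false} := by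
      intro u
      simp only [mem_filter, mem_union]
      rintro ⟨a, b⟩
      have hne : u ≠ w := by rintro rfl; exact lt_irrefl _ b
      cases h : f u <;> simp [hne, a, b]
    have h3 := (card_le_card hs).trans (card_union_le _ _)
    simp only [if_true] at ht hf
    omega

open Finset in
open Classical in
lemma popular {V γ : Type} [Fintype γ] (c : V → γ) (S : Finset V) [Nonempty γ] :
    ∃ y, #S ≤ Fintype.card γ * #{u ∈ S | c u = y} := by
  by_contra hcon
  push Not at hcon
  have h1 : #S = ∑ y, #{u ∈ S | c u = y} := card_eq_sum_card_fiberwise (by simp)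
  have h2 : ∑ y : γ, Fintype.card γ * #{u ∈ S | c u = y} < ∑ y : γ, #S :=
    sum_lt_sum_of_nonempty univ_nonempty (fun y _ => hcon y)
  rw [← mul_sum, ← h1] at h2
  simp at h2

/-- Destroying all cycles of types (2,1), (3,2) and (2,1,1,1). -/
lemma stage_majority {V : Type} [Fintype V] (N : V → Finset V) (hirr : ∀ v, v ∉ N v) (act : Set V)
    (k : ℕ) (hN : ∀ v ∈ act, 32 * k ≤ (N v).card) :
    ∃ S : V → Finset V, (∀ v, S v ⊆ N v) ∧ (∀ v ∈ act, k ≤ (S v).card) ∧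
      (∀ w a e, a ∈ S w → e ∈ S w → e ∈ S a → False) ∧
      (∀ w a b z e, a ∈ S w → b ∈ S a → z ∈ S b → e ∈ S w → z ∈ S e → False) ∧
      (∀ w a z e y, a ∈ S w → z ∈ S a → e ∈ S w → e ∈ S y → z ∈ S y → False) := by
  classical
  let x : V → ℝ := fun v => ((Fintype.equivFin V v : ℕ) : ℝ)
  have hx : Function.Injective x := by
    intro a b h
    simp only [x, Nat.cast_inj] at h
    exact (Fintype.equivFin V).injective (Fin.ext h)
  obtain ⟨c1, hc1⟩ := half_colour N x
  obtain ⟨c2, hc2⟩ := half_colour N (fun v => - x v)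
  let c : V → Bool × Bool := fun v => (c1 v, c2 v)
  let N1 : V → Finset V := fun w => (N w).filter (fun u => c u ≠ c w)
  have hN1 : ∀ w, (N w).card ≤ 2 * (N1 w).card := by
    intro w
    have h1 := hc1 w
    have h2 := hc2 w
    have hs : N w ⊆ {u ∈ N w | x w < x u} ∪ {u ∈ N w | - x w < - x u} := by
      intro u hu
      have hne : x w ≠ x u := fun h => hirr w (hx h ▸ hu)
      simp only [Finset.mem_union, Finset.mem_filter]
      rcases lt_or_gt_of_ne hne with h | h
      · exact Or.inl ⟨hu, h⟩
      · exact Or.inr ⟨hu, by linarith⟩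
    have h3 := (Finset.card_le_card hs).trans (Finset.card_union_le _ _)
    have h4 : Disjoint {u ∈ N w | x w < x u ∧ c1 u ≠ c1 w} {u ∈ N w | - x w < - x u ∧ c2 u ≠ c2 w} := by
      rw [Finset.disjoint_left]
      intro u h h'
      simp only [Finset.mem_filter] at h h'
      linarith [h.2.1, h'.2.1]
    have h5 : {u ∈ N w | x w < x u ∧ c1 u ≠ c1 w} ∪ {u ∈ N w | - x w < - x u ∧ c2 u ≠ c2 w} ⊆ N1 w := by
      intro u
      simp only [Finset.mem_union, Finset.mem_filter, N1, c, ne_eq, Prod.mk.injEq]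
      tauto
    have h6 := Finset.card_le_card h5
    rw [Finset.card_union_of_disjoint h4] at h6
    omega
  have hp : ∀ w, ∃ y, (N1 w).card ≤ 4 * ((N1 w).filter (fun u => c u = y)).card := by
    intro w
    obtain ⟨y, hy⟩ := popular c (N1 w)
    rw [show Fintype.card (Bool × Bool) = 4 from rfl] at hy
    exact ⟨y, by convert hy⟩
  choose col hcol using hp
  let N2 : V → Finset V := fun w => (N1 w).filter (fun u => c u = col w)
  have hp : ∀ w, ∃ y, (N2 w).card ≤ 4 * ((N2 w).filter (fun u => col u = y)).card := by
    intro w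
    obtain ⟨y, hy⟩ := popular col (N2 w)
    rw [show Fintype.card (Bool × Bool) = 4 from rfl] at hy
    exact ⟨y, by convert hy⟩
  choose col2 hcol2 using hp
  let N3 : V → Finset V := fun w => (N2 w).filter (fun u => col u = col2 w)
  have key : ∀ u v, u ∈ N3 v → c u ≠ c v ∧ c u = col v ∧ col u = col2 v := by
    intro u v h
    simp only [N3, N2, N1, Finset.mem_filter] at h
    tauto
  refine ⟨N3, ?_, ?_, ?_, ?_, ?_⟩
  · intro v u h
    simp only [N3, N2, N1, Finset.mem_filter] at h
    exact h.1.1.1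
  · intro v hv
    have h1 := hN v hv
    have h2 := hN1 v
    have h3 : (N1 v).card ≤ 4 * (N2 v).card := hcol v
    have h4 : (N2 v).card ≤ 4 * (N3 v).card := hcol2 v
    omega
  · intro w a e h1 h2 h3
    exact (key _ _ h3).1 ((key _ _ h2).2.1.trans (key _ _ h1).2.1.symm)
  · intro w a b z e h1 h2 h3 h4 h5
    apply (key _ _ h3).1
    rw [(key _ _ h5).2.1, (key _ _ h2).2.1, (key _ _ h4).2.2, (key _ _ h1).2.2]
  · intro w a z e y h1 h2 h3 h4 h5
    apply (key _ _ h2).1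
    rw [(key _ _ h5).2.1, ← (key _ _ h4).2.1, (key _ _ h3).2.1, (key _ _ h1).2.1]

open Finset in
open Classical in
lemma exists_weights {V : Type} [Fintype V] (N : V → Finset V) (d : ℕ) (hd : 1 ≤ d)
    (hN : ∀ v, #(N v) ≤ d) :
    ∃ x : V → ℝ, (∀ v, 0 < x v) ∧ ∀ u, ∑ v with u ∈ N v, x v ≤ 2 * d * x u := by
  have hd0 : (0:ℝ) < d := by exact_mod_cast hd
  let T : (V → ℝ) → V → ℝ := fun y u => (1 / (2 * d)) * ∑ v with u ∈ N v, y v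
  let y : ℕ → V → ℝ := fun n => Nat.rec (fun _ => 1) (fun _ z => T z) n
  have hy0 : ∀ u, y 0 u = 1 := fun _ => rfl
  have hy1 : ∀ n u, y (n+1) u = (1 / (2 * d)) * ∑ v with u ∈ N v, y n v := fun _ _ => rfl
  have hpos : ∀ n u, 0 ≤ y n u := by
    intro n
    induction n with
    | zero => intro u; rw [hy0]; norm_num
    | succ n ih =>
      intro u
      rw [hy1]
      exact mul_nonneg (by positivity) (sum_nonneg fun v _ => ih v)
  have htot : ∀ n, ∑ u, y n u ≤ Fintype.card V * (1/2:ℝ)^n := by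
    intro n
    induction n with
    | zero => simp [hy0]
    | succ n ih =>
      have h1 : ∑ u, y (n+1) u = (1 / (2 * d)) * ∑ v, #(N v) * y n v := by
        simp_rw [hy1]
        rw [← mul_sum]
        congr 1
        simp_rw [sum_filter]
        rw [sum_comm]
        refine sum_congr rfl fun v _ => ?_
        rw [← sum_filter, sum_const, nsmul_eq_mul]
        congr 2
        simp
      have h2 : ∑ v, #(N v) * y n v ≤ ∑ v, d * y n v := by
        refine sum_le_sum fun v _ => ?_
        have := hpos n v
        gcongr
        exact hN v
      rw [← mul_sum] at h2
      rw [h1, pow_succ]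
      calc (1 / (2 * d)) * ∑ v, #(N v) * y n v ≤ (1 / (2 * d)) * (d * ∑ v, y n v) := by gcongr
        _ = (∑ v, y n v) * (1/2) := by field_simp
        _ ≤ (Fintype.card V * (1/2:ℝ)^n) * (1/2) := by gcongr
        _ = _ := by ring
  obtain ⟨n, hn⟩ : ∃ n : ℕ, Fintype.card V * (1/2:ℝ)^n ≤ 1 := by
    obtain ⟨n, hn⟩ := pow_unbounded_of_one_lt (Fintype.card V : ℝ) (one_lt_two)
    refine ⟨n, ?_⟩
    rw [one_div, inv_pow]
    rw [mul_inv_le_iff₀ (by positivity)]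
    linarith
  have hyn : ∀ u, y n u ≤ 1 := by
    intro u
    exact (single_le_sum (fun v _ => hpos n v) (mem_univ u)).trans ((htot n).trans hn)
  have hx : ∀ u, 1 / (2 * d) * ∑ v with u ∈ N v, (∑ i ∈ range (n+1), y i v) ≤ ∑ i ∈ range (n+1), y i u := by
    intro u
    rw [sum_comm, mul_sum]
    simp_rw [← hy1]
    have h1 := Finset.sum_range_succ (fun i => y (i+1) u) n
    have h2 := Finset.sum_range_succ' (fun i => y i u) (n+1)
    have h3 := Finset.sum_range_succ (fun i => y i u) (n+1)
    rw [hy0] at h2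
    have h4 := htot (n+1)
    have h5 : y (n+1) u ≤ 1 := by
      refine (single_le_sum (fun v _ => hpos (n+1) v) (mem_univ u)).trans (h4.trans (le_trans ?_ hn))
      rw [pow_succ]
      have : 0 ≤ (Fintype.card V : ℝ) * (1/2)^n := by positivity
      linarith
    linarith
  refine ⟨fun u => ∑ i ∈ range (n+1), y i u, ?_, ?_⟩
  · intro u
    beta_reduce
    rw [sum_range_succ']
    have := sum_nonneg (s := range n) (f := fun i => y (i+1) u) (fun i _ => hpos (i+1) u)
    rw [hy0]; linarith
  · intro u
    have := hx u
    rw [one_div, inv_mul_le_iff₀ (by positivity)] at this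
    exact this

open Finset in
open Classical in
lemma exists_independent {X : Type} (R : X → X → Prop) (D k : ℕ) (S : Finset X)
    (hR : ∀ a ∈ S, #{e ∈ S | R a e} ≤ D) (hS : k * (2 * D + 1) ≤ #S) :
    ∃ T ⊆ S, #T = k ∧ ∀ a ∈ T, ∀ e ∈ T, a ≠ e → ¬ R a e := by
  induction k generalizing S with
  | zero => exact ⟨∅, by simp, by simp, by simp⟩
  | succ k ih =>
    have hpos : 0 < #S := by nlinarith
    obtain ⟨e, heS, he⟩ : ∃ e ∈ S, #{a ∈ S | R a e} ≤ D := by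
      by_contra hcon
      push Not at hcon
      have h1 : ∑ e ∈ S, #{a ∈ S | R a e} = ∑ a ∈ S, #{e ∈ S | R a e} := by
        simp_rw [card_filter]
        exact sum_comm
      have h2 : ∑ e ∈ S, D < ∑ e ∈ S, #{a ∈ S | R a e} :=
        sum_lt_sum_of_nonempty (card_pos.1 hpos) hcon
      have h3 := sum_le_sum hR
      omega
    let bad : Finset X := insert e ({a ∈ S | R a e} ∪ {a ∈ S | R e a})
    have hbad : #bad ≤ 2 * D + 1 := by
      refine (card_insert_le _ _).trans ?_
      have := card_union_le {a ∈ S | R a e} {a ∈ S | R e a}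
      have := hR e heS
      omega
    obtain ⟨T, hTS, hTc, hT⟩ := ih (S \ bad) (by
      intro a ha
      refine le_trans (card_le_card ?_) (hR a (mem_sdiff.1 ha).1)
      exact filter_subset_filter _ sdiff_subset) (by
      have := le_card_sdiff bad S
      have h2 : (k+1) * (2*D+1) = k * (2*D+1) + (2*D+1) := by ring
      omega)
    have heT : e ∉ T := fun h => by
      have := hTS h
      simp [bad] at this
    have hno : ∀ a ∈ T, ¬ R a e ∧ ¬ R e a := by
      intro a ha
      have := hTS ha
      simp only [bad, mem_sdiff, mem_insert, mem_union, mem_filter] at this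
      tauto
    refine ⟨insert e T, ?_, ?_, ?_⟩
    · exact insert_subset heS (hTS.trans sdiff_subset)
    · rw [card_insert_of_notMem heT, hTc]
    · intro a ha b hb hab
      rw [mem_insert] at ha hb
      rcases ha with rfl | ha <;> rcases hb with rfl | hb
      · exact absurd rfl hab
      · exact (hno b hb).2
      · exact (hno a ha).1
      · exact hT a ha b hb hab

/-- A set of vertex-disjoint ordered pairs. -/
def IsPairMatching {X : Type} (M : Finset (X × X)) : Prop :=
  (∀ p ∈ M, p.1 ≠ p.2) ∧
  ∀ p ∈ M, ∀ p' ∈ M, p ≠ p' → p.1 ≠ p'.1 ∧ p.1 ≠ p'.2 ∧ p.2 ≠ p'.1 ∧ p.2 ≠ p'.2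

open Finset in
open Classical in
lemma matching_or_independent {X : Type} (R : X → X → Prop) (C : ℕ) (S : Finset X) :
    (∃ M : Finset (X × X), #M = C ∧ IsPairMatching M ∧
      ∀ p ∈ M, p.1 ∈ S ∧ p.2 ∈ S ∧ R p.1 p.2) ∨
    ∃ T ⊆ S, #S ≤ #T + 2 * C ∧ ∀ a ∈ T, ∀ e ∈ T, a ≠ e → ¬ R a e := by
  induction C generalizing S with
  | zero => exact Or.inl ⟨∅, by simp, by simp [IsPairMatching], by simp⟩
  | succ C ih =>
    by_cases hind : ∀ a ∈ S, ∀ e ∈ S, a ≠ e → ¬ R a e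
    · exact Or.inr ⟨S, Subset.rfl, by omega, hind⟩
    · push Not at hind
      obtain ⟨a, ha, e, he, hae, hR⟩ := hind
      rcases ih (S \ {a, e}) with ⟨M, hM, hM1, hM2⟩ | ⟨T, hT, hc, hTi⟩
      · left
        have hnot : ∀ p ∈ M, p.1 ≠ a ∧ p.1 ≠ e ∧ p.2 ≠ a ∧ p.2 ≠ e := by
          intro p hp
          have := hM2 p hp
          simp only [mem_sdiff, mem_insert, mem_singleton] at this
          tauto
        refine ⟨insert (a, e) M, ?_, ⟨?_, ?_⟩, ?_⟩
        · rw [card_insert_of_notMem, hM]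
          intro h
          exact (hnot _ h).1 rfl
        · intro p hp
          rw [mem_insert] at hp
          rcases hp with rfl | hp
          · exact hae
          · exact hM1.1 p hp
        · intro p hp p' hp' hne
          rw [mem_insert] at hp hp'
          rcases hp with rfl | hp <;> rcases hp' with rfl | hp'
          · exact absurd rfl hne
          · have := hnot p' hp'
            exact ⟨this.1.symm, this.2.2.1.symm, this.2.1.symm, this.2.2.2.symm⟩
          · have := hnot p hp
            exact ⟨this.1, this.2.1, this.2.2.1, this.2.2.2⟩
          · exact hM1.2 p hp p' hp' hne
        · intro p hp
          rw [mem_insert] at hp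
          rcases hp with rfl | hp
          · exact ⟨ha, he, hR⟩
          · have := hM2 p hp
            exact ⟨(mem_sdiff.1 this.1).1, (mem_sdiff.1 this.2.1).1, this.2.2⟩
      · right
        refine ⟨T, hT.trans sdiff_subset, ?_, hTi⟩
        have h1 := le_card_sdiff {a, e} S
        have h2 : #({a, e} : Finset X) ≤ 2 := card_le_two
        omega

open Finset in
open Classical in
lemma conflict_count {V : Type} [Fintype V] {k q : ℕ} [Nonempty (Fin q)] (E : Fin k × Fin q → V)
    (hE : Function.Injective E) (R : V → V → Prop) (D C : ℕ)
    (hR : ∀ a, #{e | R a e} ≤ D) :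
    q ^ C * #{ω : Fin k → Fin q | ∃ M : Finset (Fin k × Fin k), #M = C ∧ IsPairMatching M ∧
      ∀ p ∈ M, R (E (p.1, ω p.1)) (E (p.2, ω p.2))} ≤
    ((k ^ 2) ^ C * D ^ C) * Fintype.card (Fin k → Fin q) := by
  have key : ∀ M : Finset (Fin k × Fin k), IsPairMatching M →
      q ^ #M * #{ω : Fin k → Fin q | ∀ p ∈ M, R (E (p.1, ω p.1)) (E (p.2, ω p.2))} ≤
        D ^ #M * Fintype.card (Fin k → Fin q) := by
    intro M
    induction M using Finset.induction_on with
    | empty => intro _; simp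
    | insert p M hp ih =>
      intro hM
      have ih := ih ⟨fun p' h => hM.1 p' (mem_insert_of_mem h),
        fun p' h p'' h' => hM.2 p' (mem_insert_of_mem h) p'' (mem_insert_of_mem h')⟩
      have h1 := fiber_count (V := Fin k) (Ω := Fin q) p.2
        ({ω : Fin k → Fin q | ∀ p ∈ M, R (E (p.1, ω p.1)) (E (p.2, ω p.2))})
        (by
          intro σ ω h
          simp only [mem_filter, mem_univ, true_and] at h ⊢
          intro p' hp'
          have hne : p ≠ p' := by rintro rfl; exact hp hp'
          have := hM.2 p (mem_insert_self _ _) p' (mem_insert_of_mem hp') hne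
          rw [Function.update_of_ne this.2.2.1.symm, Function.update_of_ne this.2.2.2.symm]
          exact h p' hp')
        (fun ω => R (E (p.1, ω p.1)) (E (p.2, ω p.2))) q D (by
          intro σ _
          rw [Fintype.card_fin, mul_comm]
          gcongr
          refine le_trans ?_ (hR (E (p.1, σ p.1)))
          apply card_le_card_of_injOn (fun i => E (p.2, i))
          · intro i hi
            have := hM.1 p (mem_insert_self _ _)
            simp only [coe_filter, mem_univ, true_and, Set.mem_ofPred_eq,
              Function.update_of_ne this, Function.update_self] at hi
            simpa using hi
          · intro i _ j _ hij
            have := hE hij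
            simpa using this)
      rw [card_insert_of_notMem hp, pow_succ, pow_succ]
      have h2 : ({ω : Fin k → Fin q | ∀ p' ∈ insert p M, R (E (p'.1, ω p'.1)) (E (p'.2, ω p'.2))} : Finset _) ⊆
        ({ω : Fin k → Fin q | ∀ p ∈ M, R (E (p.1, ω p.1)) (E (p.2, ω p.2))} : Finset _).filter (fun ω => R (E (p.1, ω p.1)) (E (p.2, ω p.2))) := by
        intro ω
        simp only [mem_filter, mem_univ, true_and, mem_insert, forall_eq_or_imp]
        tauto
      calc _ ≤ q ^ #M * (q * #(({ω : Fin k → Fin q | ∀ p ∈ M, R (E (p.1, ω p.1)) (E (p.2, ω p.2))} : Finset _).filter (fun ω => R (E (p.1, ω p.1)) (E (p.2, ω p.2))))) := by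
            rw [mul_assoc]
            gcongr
        _ ≤ q ^ #M * (D * #({ω : Fin k → Fin q | ∀ p ∈ M, R (E (p.1, ω p.1)) (E (p.2, ω p.2))} : Finset _)) := by
            gcongr
        _ = D * (q ^ #M * #({ω : Fin k → Fin q | ∀ p ∈ M, R (E (p.1, ω p.1)) (E (p.2, ω p.2))} : Finset _)) := by ring
        _ ≤ D * (D ^ #M * Fintype.card (Fin k → Fin q)) := by gcongr
        _ = _ := by ring
  let Ms : Finset (Finset (Fin k × Fin k)) := (powersetCard C univ).filter IsPairMatching
  have hMs : #Ms ≤ (k^2)^C := by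
    refine (card_filter_le _ _).trans ?_
    rw [card_powersetCard]
    refine (Nat.choose_le_pow _ _).trans ?_
    simp [sq]
  have hsub : ({ω : Fin k → Fin q | ∃ M : Finset (Fin k × Fin k), #M = C ∧ IsPairMatching M ∧
      ∀ p ∈ M, R (E (p.1, ω p.1)) (E (p.2, ω p.2))} : Finset _) ⊆
      Ms.biUnion (fun M => {ω : Fin k → Fin q | ∀ p ∈ M, R (E (p.1, ω p.1)) (E (p.2, ω p.2))}) := by
    intro ω
    simp only [mem_filter, mem_univ, true_and, mem_biUnion, Ms, mem_powersetCard, subset_univ]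
    rintro ⟨M, h1, h2, h3⟩
    exact ⟨M, ⟨h1, h2⟩, h3⟩
  calc _ ≤ q ^ C * ∑ M ∈ Ms, #{ω : Fin k → Fin q | ∀ p ∈ M, R (E (p.1, ω p.1)) (E (p.2, ω p.2))} := by
        gcongr
        exact (card_le_card hsub).trans card_biUnion_le
    _ = ∑ M ∈ Ms, q ^ C * #{ω : Fin k → Fin q | ∀ p ∈ M, R (E (p.1, ω p.1)) (E (p.2, ω p.2))} := mul_sum _ _ _
    _ ≤ ∑ M ∈ Ms, D ^ C * Fintype.card (Fin k → Fin q) := by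
        refine sum_le_sum fun M hM => ?_
        simp only [Ms, mem_filter, mem_powersetCard] at hM
        have := key M hM.2
        rw [hM.1.2] at this
        exact this
    _ = #Ms * (D ^ C * Fintype.card (Fin k → Fin q)) := by simp
    _ ≤ (k^2)^C * (D ^ C * Fintype.card (Fin k → Fin q)) := by gcongr
    _ = _ := by ring

open Finset in
open Classical in
lemma reach_three {V : Type} (S : V → Finset V) (D : ℕ) (hS : ∀ v, #(S v) ≤ D) (a : V) :
    #((S a).biUnion fun b => (S b).biUnion S) ≤ D ^ 3 := by
  refine (card_biUnion_le_card_mul _ _ (D^2) ?_).trans ?_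
  · intro b _
    refine (card_biUnion_le_card_mul _ _ D (fun v _ => hS v)).trans ?_
    rw [sq]
    gcongr
    exact hS b
  · rw [show D^3 = D * D^2 by ring]
    gcongr
    exact hS a

/-- The conflict relation at `w`. -/
def Conf {V : Type} (S : V → Finset V) (w a e : V) : Prop :=
  ∃ b z, b ∈ S a ∧ z ∈ S b ∧ e ∈ S z ∧ a ≠ w ∧ b ≠ w ∧ z ≠ w

open Finset in
open Classical in
lemma conf_count {V : Type} [Fintype V] (S : V → Finset V) (D : ℕ) (hS : ∀ v, #(S v) ≤ D) (w a : V) :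
    #{e | Conf S w a e} ≤ D ^ 3 := by
  refine le_trans (card_le_card ?_) (reach_three S D hS a)
  intro e
  simp only [mem_filter, mem_univ, true_and, mem_biUnion]
  rintro ⟨b, z, h1, h2, h3, -⟩
  exact ⟨b, h1, z, h2, h3⟩

lemma stage_flat {V : Type} [Fintype V] (N : V → Finset V) (act flat : Set V) (k q : ℕ)
    (hk : 1 ≤ k) (hq : 2 ^ 12 * k ^ 59 ≤ q)
    (hfa : flat ⊆ act)
    (hact : ∀ v ∈ act, (N v).card = k * q) (hina : ∀ v, v ∉ act → N v = ∅)
    (hin : ∀ e, (open Classical in Finset.univ.filter (fun w => w ∈ flat ∧ e ∈ N w)).card ≤ 64 * (k * q) ^ 3) :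
    ∃ S : V → Finset V, (∀ v, S v ⊆ N v) ∧ (∀ v ∈ act, (S v).card = k) ∧
      ∀ w ∈ flat, ∃ T ⊆ S w, k ≤ T.card + 20 ∧ ∀ a ∈ T, ∀ e ∈ T, a ≠ e → ¬ Conf S w a e := by
  classical
  have hk59 : 1 ≤ k^59 := Nat.one_le_pow _ _ hk
  have hq0 : 0 < q := by omega
  have : Nonempty (Fin q) := ⟨⟨0, hq0⟩⟩
  obtain ⟨e, he⟩ := exists_embeddings N act k q hact
  have hd1 : 1 ≤ k * q := Nat.mul_pos hk hq0
  obtain ⟨d, hd⟩ : ∃ d, d = k * q := ⟨_, rfl⟩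
  have hNd : ∀ v, (N v).card ≤ d := by
    intro v
    by_cases hv : v ∈ act
    · rw [hact v hv, hd]
    · simp [hina v hv]
  let Sel : (V → Fin k → Fin q) → V → Finset V := fun σ v =>
    if v ∈ act then Finset.univ.image (fun g => e v (g, σ v g)) else ∅
  have hSelN : ∀ σ v, Sel σ v ⊆ N v := by
    intro σ v u hu
    by_cases hv : v ∈ act
    · simp only [Sel, hv, if_true, Finset.mem_image, Finset.mem_univ, true_and] at hu
      obtain ⟨g, rfl⟩ := hu
      exact (he v hv).2 _
    · simp [Sel, hv] at hu
  have hSelc : ∀ σ, ∀ v ∈ act, (Sel σ v).card = k := by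
    intro σ v hv
    simp only [Sel, hv, if_true]
    rw [Finset.card_image_of_injective]
    · simp
    · intro a b hab
      have := (he v hv).1 hab
      simp at this
      exact this.1
  have hSelle : ∀ σ v, (Sel σ v).card ≤ k := by
    intro σ v
    by_cases hv : v ∈ act
    · exact (hSelc σ v hv).le
    · simp [Sel, hv]
  have hSelcongr : ∀ σ τ v, σ v = τ v → Sel σ v = Sel τ v := by
    intro σ τ v h
    simp only [Sel, h]
  let vb : V → Finset V := fun w => insert w (Finset.univ.filter (fun y =>
    ∃ a b z u, a ∈ N w ∧ b ∈ N a ∧ z ∈ N b ∧ u ∈ N z ∧ u ∈ N w ∧ (y = a ∨ y = b ∨ y = z)))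
  obtain ⟨σ, hσ⟩ := local_lemma (V := V) (Ω := Fin k → Fin q) (ι := {w // w ∈ flat})
    (fun w σ => ∃ M : Finset (Fin k × Fin k), M.card = 10 ∧ IsPairMatching M ∧
      ∀ p ∈ M, Conf (Sel σ) w.1 (e w.1 (p.1, σ w.1 p.1)) (e w.1 (p.2, σ w.1 p.2)))
    (fun w => vb w.1) (4 * d ^ 3) (4 * d ^ 3 * (64 * d ^ 3)) (2 ^ 12 * d ^ 9)
    (by have : 1 ≤ d^3 := Nat.one_le_pow _ _ (by omega)
        omega)
    (by have : 1 ≤ d^9 := Nat.one_le_pow _ _ (by omega)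
        omega) 
    (by
      rintro ⟨w, hw⟩
      have h1 : vb w ⊆ insert w (N w ∪ ((N w).biUnion N ∪ (N w).biUnion (fun b => (N b).biUnion N))) := by
        intro y hy
        simp only [vb, Finset.mem_insert, Finset.mem_filter, Finset.mem_univ, true_and] at hy
        simp only [Finset.mem_insert, Finset.mem_union, Finset.mem_biUnion]
        rcases hy with rfl | ⟨a, b, z, u, ha, hb, hz, hu, hu', rfl | rfl | rfl⟩
        · exact Or.inl rfl
        · exact Or.inr (Or.inl ha)
        · exact Or.inr (Or.inr (Or.inl ⟨a, ha, hb⟩))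
        · exact Or.inr (Or.inr (Or.inr ⟨a, ha, b, hb, hz⟩))
      refine (Finset.card_le_card h1).trans ((Finset.card_insert_le _ _).trans ?_)
      have h2 := Finset.card_union_le (N w) ((N w).biUnion N ∪ (N w).biUnion (fun b => (N b).biUnion N))
      have h3 := Finset.card_union_le ((N w).biUnion N) ((N w).biUnion (fun b => (N b).biUnion N))
      have h4 := reach_three N d hNd w
      have h5 : ((N w).biUnion N).card ≤ d * d := by
        refine (Finset.card_biUnion_le_card_mul _ _ d (fun v _ => hNd v)).trans ?_
        gcongr
        exact hNd w
      have h6 := hNd w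
      have h7 : d * d ≤ d^3 := by
        rw [← sq]; exact Nat.pow_le_pow_right (by omega) (by omega)
      have h8 : d ≤ d * d := Nat.le_mul_self d
      have h9 : 1 ≤ d := by omega
      omega)
    (fun w => ⟨w.1, by simp [vb]⟩)
    (by
      intro y
      let Rch : Finset V := insert y (N y ∪ ((N y).biUnion N ∪ (N y).biUnion (fun b => (N b).biUnion N)))
      have h1 : ((Finset.univ.filter (fun w : {w // w ∈ flat} => y ∈ vb w.1)).image (fun w => w.1)) ⊆
          insert y ((N y ∪ ((N y).biUnion N ∪ (N y).biUnion (fun b => (N b).biUnion N))).biUnion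
            (fun u => Finset.univ.filter (fun w => w ∈ flat ∧ u ∈ N w))) := by
        intro w hw
        simp only [Finset.mem_image, Finset.mem_filter, Finset.mem_univ, true_and, vb,
          Finset.mem_insert] at hw
        obtain ⟨⟨w, hwf⟩, hw, rfl⟩ := hw
        simp only [Finset.mem_insert, Finset.mem_union, Finset.mem_biUnion, Finset.mem_filter,
          Finset.mem_univ, true_and]
        rcases hw with rfl | ⟨a, b, z, u, ha, hb, hz, hu, hu', rfl | rfl | rfl⟩
        · exact Or.inl rfl
        · exact Or.inr ⟨u, Or.inr (Or.inr ⟨b, hb, z, hz, hu⟩), hwf, hu'⟩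
        · exact Or.inr ⟨u, Or.inr (Or.inl ⟨z, hz, hu⟩), hwf, hu'⟩
        · exact Or.inr ⟨u, Or.inl hu, hwf, hu'⟩
      have h0 := Finset.card_le_card h1
      rw [Finset.card_image_of_injective _ Subtype.val_injective] at h0
      have hcc : (Finset.univ.filter (fun w : {w // w ∈ flat} => y ∈ vb w.1)).card ≤
          4 * d ^ 3 * (64 * d ^ 3) := by
        refine h0.trans ((Finset.card_insert_le _ _).trans ?_)
        have h2 := Finset.card_union_le (N y) ((N y).biUnion N ∪ (N y).biUnion (fun b => (N b).biUnion N))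
        have h3 := Finset.card_union_le ((N y).biUnion N) ((N y).biUnion (fun b => (N b).biUnion N))
        have h4 := reach_three N d hNd y
        have h5 : ((N y).biUnion N).card ≤ d * d := by
          refine (Finset.card_biUnion_le_card_mul _ _ d (fun v _ => hNd v)).trans ?_
          gcongr
          exact hNd y
        have h6 := hNd y
        have h7 : d * d ≤ d^3 := by
          rw [← sq]; exact Nat.pow_le_pow_right (by omega) (by omega)
        have h8 : d ≤ d * d := Nat.le_mul_self d
        have h9 : 1 ≤ d := by omega
        have h10 := Finset.card_biUnion_le_card_mul (N y ∪ ((N y).biUnion N ∪ (N y).biUnion (fun b => (N b).biUnion N)))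
          (fun u => Finset.univ.filter (fun w => w ∈ flat ∧ u ∈ N w)) (64 * d^3) (by
            intro u _
            rw [hd]
            convert hin u)
        have h11 : (N y ∪ ((N y).biUnion N ∪ (N y).biUnion (fun b => (N b).biUnion N))).card ≤ 3 * d^3 := by omega
        have h12 : 1 ≤ d^3 := Nat.one_le_pow _ _ h9
        have h13 := Nat.mul_le_mul_right (64 * d^3) h11
        nlinarith
      convert hcc)
    (by
      rintro ⟨w, hw⟩ σ τ hστ ⟨M, hMc, hM, hconf⟩
      refine ⟨M, hMc, hM, ?_⟩
      intro p hp
      obtain ⟨b, z, hb, hz, hu, h1, h2, h3⟩ := hconf p hp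
      have hw0 : σ w = τ w := hστ w (by simp [vb])
      simp only at hb hz hu h1 h2 h3 ⊢
      rw [hw0] at hb h1 hu
      have hvb : ∀ y, (y = e w (p.1, τ w p.1) ∨ y = b ∨ y = z) → σ y = τ y := by
        intro y hy
        apply hστ
        simp only [vb, Finset.mem_insert, Finset.mem_filter, Finset.mem_univ, true_and]
        exact Or.inr ⟨_, b, z, _, (he w (hfa hw)).2 (p.1, τ w p.1), hSelN _ _ hb, hSelN _ _ hz,
          hSelN _ _ hu, (he w (hfa hw)).2 _, hy⟩
      refine ⟨b, z, ?_, ?_, ?_, h1, h2, h3⟩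
      · rw [← hSelcongr σ τ _ (hvb _ (Or.inl rfl))]; exact hb
      · rw [← hSelcongr σ τ _ (hvb _ (Or.inr (Or.inl rfl)))]; exact hz
      · rw [← hSelcongr σ τ _ (hvb _ (Or.inr (Or.inr rfl)))]; exact hu)
    (by
      rintro ⟨w, hw⟩ B hB
      have h1 := fiber_count w B (by
        intro σ ω hσ
        refine hB σ _ ?_ hσ
        intro v hv
        rw [Function.update_of_ne]
        rintro rfl
        simp [vb] at hv)
        (fun σ => ∃ M : Finset (Fin k × Fin k), M.card = 10 ∧ IsPairMatching M ∧
          ∀ p ∈ M, Conf (Sel σ) w (e w (p.1, σ w p.1)) (e w (p.2, σ w p.2))) (q^10)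
          ((k^2)^10 * (k^3)^10) (by
          intro σ _
          have h2 := conflict_count (e w) (he w (hfa hw)).1 (Conf (Sel σ) w) (k^3) 10
            (fun a => conf_count (Sel σ) k (hSelle σ) w a)
          refine le_trans ?_ h2
          refine Nat.mul_le_mul_left _ (Finset.card_le_card ?_)
          intro ω hω
          simp only [Finset.mem_filter, Finset.mem_univ, true_and, Function.update_self] at hω ⊢
          obtain ⟨M, hMc, hM, hconf⟩ := hω
          refine ⟨M, hMc, hM, fun p hp => ?_⟩
          obtain ⟨b, z, hb, hz, hu, g1, g2, g3⟩ := hconf p hp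
          refine ⟨b, z, ?_, ?_, ?_, g1, g2, g3⟩
          · rw [hSelcongr σ (Function.update σ w ω) _ (by rw [Function.update_of_ne g1])]; exact hb
          · rw [hSelcongr σ (Function.update σ w ω) _ (by rw [Function.update_of_ne g2])]; exact hz
          · rw [hSelcongr σ (Function.update σ w ω) _ (by rw [Function.update_of_ne g3])]; exact hu)
      have hK : 0 < (k^2)^10 * (k^3)^10 := by positivity
      have hPK : (k^2)^10 * (k^3)^10 * (2^12 * d^9) ≤ q^10 := by
        calc (k^2)^10 * (k^3)^10 * (2^12 * d^9) = q^9 * (2^12 * k^59) := by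
              rw [hd]; ring
          _ ≤ q^9 * q := by gcongr
          _ = q^10 := by ring
      refine Nat.le_of_mul_le_mul_left ?_ hK
      refine le_trans ?_ h1
      rw [← mul_assoc]
      refine Nat.mul_le_mul hPK (le_of_eq ?_)
      congr)
    (by
      have : 4 * (4 * d ^ 3 * (64 * d ^ 3)) * (4 * d^3) = 2^12 * d^9 := by ring
      rw [this])
  refine ⟨Sel σ, hSelN σ, hSelc σ, ?_⟩
  intro w hw
  rcases matching_or_independent (fun g g' => Conf (Sel σ) w (e w (g, σ w g)) (e w (g', σ w g'))) 10
    (Finset.univ : Finset (Fin k)) with ⟨M, hMc, hM, hM2⟩ | ⟨T, -, hTc, hT⟩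
  · exact absurd ⟨M, hMc, hM, fun p hp => (hM2 p hp).2.2⟩ (hσ ⟨w, hw⟩)
  · refine ⟨T.image (fun g => e w (g, σ w g)), ?_, ?_, ?_⟩
    · simp only [Sel, hfa hw, if_true]
      exact Finset.image_subset_image (Finset.subset_univ _)
    · rw [Finset.card_image_of_injective]
      · simpa using hTc
      · intro a b hab
        have := (he w (hfa hw)).1 hab
        simp at this
        exact this.1
    · intro a ha u hu hau
      rw [Finset.mem_image] at ha hu
      obtain ⟨g, hg, rfl⟩ := ha
      obtain ⟨g', hg', rfl⟩ := hu
      refine hT g hg g' hg' ?_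
      rintro rfl
      exact hau rfl

/-- Destroying all cycles of type (4,1). -/
lemma stage_four_one {V : Type} [Fintype V] (N : V → Finset V) (act : Set V) (K k q : ℕ)
    (hK : 1 ≤ K) (hk : k = 23 * K ^ 4) (hq : 2 ^ 12 * k ^ 59 ≤ q)
    (hN : ∀ v ∈ act, 2 * (k * q) ≤ (N v).card) :
    ∃ S : V → Finset V, (∀ v, S v ⊆ N v) ∧ (∀ v ∈ act, K ≤ (S v).card) ∧
      ∀ w a b z e, a ≠ w → b ≠ w → z ≠ w → a ≠ e → a ∈ S w → b ∈ S a → z ∈ S b →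
        e ∈ S z → e ∈ S w → False := by
  classical
  have hK4 : K ≤ K^4 := Nat.le_self_pow (by omega) K
  have hk1 : 1 ≤ k := by omega
  have hk59 : 1 ≤ k^59 := Nat.one_le_pow _ _ hk1
  have hd1 : 1 ≤ k * q := Nat.mul_pos hk1 (by omega)
  obtain ⟨d, hd⟩ : ∃ d, d = k * q := ⟨_, rfl⟩
  rw [← hd] at hN hd1
  obtain ⟨N0, hN0, hN0c, hN0e⟩ := trim_nbrs N act (2 * d) hN
  have hN0le : ∀ v, (N0 v).card ≤ 2 * d := by
    intro v
    by_cases hv : v ∈ act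
    · exact (hN0c v hv).le
    · simp [hN0e v hv]
  obtain ⟨x, hx0, hx⟩ := exists_weights N0 (2 * d) (by omega) hN0le
  have hdR : (1:ℝ) ≤ d := by exact_mod_cast hd1
  push_cast at hx
  have hxarc : ∀ v u, u ∈ N0 v → x v ≤ 4 * d * x u := by
    intro v u hu
    have h1 := hx u
    have h2 : x v ≤ ∑ v with u ∈ N0 v, x v :=
      Finset.single_le_sum (f := x) (fun i _ => (hx0 i).le) (by simpa using hu)
    linarith
  obtain ⟨M, hM⟩ : ∃ M : ℝ, M = 16 * d ^ 2 := ⟨_, rfl⟩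
  let flat : Set V := {v | v ∈ act ∧ d ≤ ((N0 v).filter (fun u => x u ≤ M * x v)).card}
  let N1 : V → Finset V := fun v => if v ∈ flat then (N0 v).filter (fun u => x u ≤ M * x v)
    else (N0 v).filter (fun u => M * x v < x u)
  have hN1 : ∀ v ∈ act, d ≤ (N1 v).card := by
    intro v hv
    by_cases hf : v ∈ flat
    · simp only [N1, hf, if_true]
      exact hf.2
    · simp only [N1, hf, if_false]
      have h1 : ¬ d ≤ ((N0 v).filter (fun u => x u ≤ M * x v)).card := fun h => hf ⟨hv, h⟩
      have h2 := Finset.card_filter_add_card_filter_not (s := N0 v) (fun u => x u ≤ M * x v)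
      rw [hN0c v hv] at h2
      simp only [not_le] at h2
      omega
  have hN1N0 : ∀ v, N1 v ⊆ N0 v := by
    intro v
    by_cases hf : v ∈ flat
    · simp only [N1, hf, if_true]; exact Finset.filter_subset _ _
    · simp only [N1, hf, if_false]; exact Finset.filter_subset _ _
  obtain ⟨N2, hN2, hN2c, hN2e⟩ := trim_nbrs N1 act d hN1
  have hflat : ∀ v ∈ flat, ∀ u ∈ N2 v, x u ≤ M * x v := by
    intro v hv u hu
    have := hN2 v hu
    simp only [N1, hv, if_true, Finset.mem_filter] at this
    exact this.2
  have hsteep : ∀ v, v ∉ flat → ∀ u ∈ N2 v, M * x v < x u := by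
    intro v hv u hu
    have := hN2 v hu
    simp only [N1, hv, if_false, Finset.mem_filter] at this
    exact this.2
  have hin : ∀ u, (Finset.univ.filter (fun w => w ∈ flat ∧ u ∈ N2 w)).card ≤ 64 * d ^ 3 := by
    intro u
    have h1 : ((Finset.univ.filter (fun w => w ∈ flat ∧ u ∈ N2 w)).card : ℝ) * x u ≤
        M * ∑ v with u ∈ N0 v, x v := by
      calc ((Finset.univ.filter (fun w => w ∈ flat ∧ u ∈ N2 w)).card : ℝ) * x u
          = ∑ w with w ∈ flat ∧ u ∈ N2 w, x u := by simp
        _ ≤ ∑ w with w ∈ flat ∧ u ∈ N2 w, M * x w := by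
          refine Finset.sum_le_sum fun w hw => ?_
          simp only [Finset.mem_filter, Finset.mem_univ, true_and] at hw
          exact hflat w hw.1 u hw.2
        _ = M * ∑ w with w ∈ flat ∧ u ∈ N2 w, x w := by rw [Finset.mul_sum]
        _ ≤ M * ∑ v with u ∈ N0 v, x v := by
          have : 0 ≤ M := by rw [hM]; positivity
          refine mul_le_mul_of_nonneg_left ?_ this
          refine Finset.sum_le_sum_of_subset_of_nonneg ?_ (fun i _ _ => (hx0 i).le)
          intro w
          simp only [Finset.mem_filter, Finset.mem_univ, true_and]
          exact fun h => hN1N0 w (hN2 w h.2)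
    have h2 : M * ∑ v with u ∈ N0 v, x v ≤ M * (2 * (2 * d) * x u) := by
      have : 0 ≤ M := by rw [hM]; positivity
      exact mul_le_mul_of_nonneg_left (hx u) this
    have h3 : ((Finset.univ.filter (fun w => w ∈ flat ∧ u ∈ N2 w)).card : ℝ) * x u ≤
        (64 * d ^ 3) * x u := by
      refine (h1.trans h2).trans (le_of_eq ?_)
      rw [hM]; ring
    have h4 := le_of_mul_le_mul_right h3 (hx0 u)
    exact_mod_cast h4
  obtain ⟨S1, hS1, hS1c, hS1f⟩ := stage_flat N2 act flat k q hk1 hq (fun v hv => hv.1)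
    (by rw [← hd]; exact hN2c) hN2e (by
      intro u
      rw [← hd]
      convert hin u)
  have hT : ∀ w, ∃ T : Finset V, w ∈ flat → (T ⊆ S1 w ∧ T.card = K ∧
      ∀ a ∈ T, ∀ e ∈ T, a ≠ e → ¬ Conf S1 w a e) := by
    intro w
    by_cases hw : w ∈ flat
    · obtain ⟨T, h1, h2, h3⟩ := hS1f w hw
      obtain ⟨T', h4, h5⟩ := Finset.exists_subset_card_eq (s := T) (n := K) (by omega)
      exact ⟨T', fun _ => ⟨h4.trans h1, h5, fun a ha e he => h3 a (h4 ha) e (h4 he)⟩⟩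
    · exact ⟨∅, fun h => absurd h hw⟩
  choose T hT using hT
  have : Nonempty {F : Finset V // F.card ≤ K} := ⟨⟨∅, by simp⟩⟩
  let CS : (V → {F : Finset V // F.card ≤ K}) → V → V → V → Prop := fun f w a e =>
    ∃ b z, b ∈ (f a).1 ∧ z ∈ (f b).1 ∧ e ∈ (f z).1 ∧ x w < x a ∧ x w < x b ∧ x w < x z
  have hCS : ∀ (f f' : V → {F : Finset V // F.card ≤ K}) w a e, (∀ y, x w < x y → f y = f' y) → CS f w a e → CS f' w a e := by
    rintro f f' w a e h ⟨b, z, h1, h2, h3, h4, h5, h6⟩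
    exact ⟨b, z, by rw [← h a h4]; exact h1, by rw [← h b h5]; exact h2,
      by rw [← h z h6]; exact h3, h4, h5, h6⟩
  obtain ⟨f, hf⟩ := greedy (β := {F : Finset V // F.card ≤ K}) x (fun w f => (w ∈ flat → (f w).1 = T w) ∧
      (w ∉ act → (f w).1 = ∅) ∧
      (w ∈ act → w ∉ flat → (f w).1 ⊆ S1 w ∧ (f w).1.card = K ∧
        ∀ a ∈ (f w).1, ∀ e ∈ (f w).1, a ≠ e → ¬ CS f w a e))
    (by
      intro w f f' h1 h2 h
      rw [h1] at h
      refine ⟨h.1, h.2.1, fun ha hs => ?_⟩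
      obtain ⟨g1, g2, g3⟩ := h.2.2 ha hs
      refine ⟨g1, g2, fun a ha e he hne hc => g3 a ha e he hne ?_⟩
      exact hCS f' f w a e (fun y hy => (h2 y hy).symm) hc)
    (by
      intro w f
      by_cases hw : w ∈ flat
      · refine ⟨⟨T w, (hT w hw).2.1.le⟩, ?_, ?_, ?_⟩
        · intro _; simp
        · intro h; exact absurd hw.1 h
        · intro _ h; exact absurd hw h
      by_cases ha : w ∈ act
      · obtain ⟨F, h1, h2, h3⟩ := exists_independent (CS f w) (K^3) K (S1 w) (by
          intro a _
          have := reach_three (fun v => (f v).1) K (fun v => (f v).2) a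
          refine le_trans (Finset.card_le_card ?_) this
          intro e
          simp only [Finset.mem_filter, Finset.mem_biUnion]
          rintro ⟨-, b, z, h1, h2, h3, -⟩
          exact ⟨b, h1, z, h2, h3⟩) (by
          rw [hS1c w ha, hk]
          have : K * (2 * K^3 + 1) = 2 * K^4 + K := by ring
          omega)
        refine ⟨⟨F, h2.le⟩, ?_, ?_, ?_⟩
        · intro h; exact absurd h hw
        · intro h; exact absurd ha h
        · intro _ _
          simp only [if_true]
          refine ⟨h1, h2, fun a ha e he hne hc => h3 a ha e he hne ?_⟩
          obtain ⟨b, z, g1, g2, g3, g4, g5, g6⟩ := hc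
          have hne' : ∀ y, x w < x y → y ≠ w := by
            rintro y hy rfl; exact lt_irrefl _ hy
          beta_reduce at g1 g2 g3
          rw [if_neg (hne' _ g4)] at g1
          rw [if_neg (hne' _ g5)] at g2
          rw [if_neg (hne' _ g6)] at g3
          exact ⟨b, z, g1, g2, g3, g4, g5, g6⟩
      · refine ⟨⟨∅, by simp⟩, ?_, ?_, ?_⟩
        · intro h; exact absurd h hw
        · intro _; simp
        · intro h; exact absurd h ha)
  have hfS1 : ∀ v, (f v).1 ⊆ S1 v := by
    intro v
    by_cases hw : v ∈ flat
    · rw [(hf v).1 hw]; exact (hT v hw).1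
    by_cases ha : v ∈ act
    · exact ((hf v).2.2 ha hw).1
    · rw [(hf v).2.1 ha]; simp
  have hfN0 : ∀ v, (f v).1 ⊆ N0 v := fun v =>
    (hfS1 v).trans ((hS1 v).trans ((hN2 v).trans (hN1N0 v)))
  refine ⟨fun v => (f v).1, fun v => (hfN0 v).trans (hN0 v), ?_, ?_⟩
  · intro v ha
    by_cases hw : v ∈ flat
    · beta_reduce
      rw [(hf v).1 hw]; exact (hT v hw).2.1.ge
    · exact ((hf v).2.2 ha hw).2.1.ge
  · intro w a b z e haw hbw hzw hae h1 h2 h3 h4 h5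
    beta_reduce at h1 h2 h3 h4 h5
    by_cases hw : w ∈ flat
    · rw [(hf w).1 hw] at h1 h5
      exact (hT w hw).2.2 a h1 e h5 hae ⟨b, z, hfS1 _ h2, hfS1 _ h3, hfS1 _ h4, haw, hbw, hzw⟩
    · have ha : w ∈ act := by
        by_contra ha
        rw [(hf w).2.1 ha] at h1
        simp at h1
      refine ((hf w).2.2 ha hw).2.2 a h1 e h5 hae ⟨b, z, h2, h3, h4, ?_⟩
      have g1 := hsteep w hw a (hS1 w (hfS1 w h1))
      have g2 := hxarc a b (hfN0 _ h2)
      have g3 := hxarc b z (hfN0 _ h3)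
      have g0 := hx0 w
      rw [hM] at g1
      have e1 : x w ≤ d * x w := by nlinarith
      have e2 : d * x w ≤ d * (d * x w) := by gcongr
      have e3 : 4 * d * (4 * d * x w) < 4 * d * x b := by
        refine lt_of_eq_of_lt ?_ (lt_of_lt_of_le g1 g2)
        ring
      have e4 : 4 * d * x w < x b := lt_of_mul_lt_mul_left e3 (by positivity)
      have e5 : x w < x z := by
        have : 4 * d * x w < 4 * d * x z := lt_of_lt_of_le e4 g3
        exact lt_of_mul_lt_mul_left this (by positivity)
      refine ⟨?_, ?_, e5⟩
      · nlinarith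
      · nlinarith

lemma finite_main {V : Type} [Fintype V] (N : V → Finset V) (hirr : ∀ v, v ∉ N v) (act : Set V)
    (K : ℕ) (hK : 1 ≤ K)
    (hN : ∀ v ∈ act, 100 * (100 * (2 ^ 18 * (23 * K ^ 4) ^ 60) ^ 5) ^ 5 ≤ (N v).card) :
    ∃ S : V → Finset V, (∀ v, S v ⊆ N v) ∧ (∀ v ∈ act, K ≤ (S v).card) ∧
      (∀ f : Fin 3 → V, Function.Injective f →
        ¬ ∀ i, f (i + 1) ∈ S (f i) ∨ f i ∈ S (f (i + 1))) ∧
      (∀ f : Fin 5 → V, Function.Injective f →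
        ¬ ∀ i, f (i + 1) ∈ S (f i) ∨ f i ∈ S (f (i + 1))) := by
  obtain ⟨k, hk⟩ : ∃ k, k = 23 * K ^ 4 := ⟨_, rfl⟩
  obtain ⟨q, hq⟩ : ∃ q, q = 2 ^ 12 * k ^ 59 := ⟨_, rfl⟩
  obtain ⟨d2, hd2⟩ : ∃ d, d = 2 ^ 18 * (23 * K ^ 4) ^ 60 := ⟨_, rfl⟩
  obtain ⟨d3, hd3⟩ : ∃ d, d = 100 * d2 ^ 5 := ⟨_, rfl⟩
  rw [← hd2, ← hd3] at hN
  have h2 : 1 ≤ d2 := by rw [hd2]; exact Nat.one_le_iff_ne_zero.2 (by positivity)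
  have h3 : 1 ≤ d3 := by rw [hd3]; exact Nat.one_le_iff_ne_zero.2 (by positivity)
  obtain ⟨S1, hS1, hS1c, hS1p⟩ := stage_directed N act 2 d3 (100 * d3 ^ 4) (by norm_num)
    (by gcongr <;> norm_num) h3 (by
      intro v hv
      refine le_trans (le_of_eq ?_) (hN v hv)
      ring)
  obtain ⟨S2, hS2, hS2c, hS2p⟩ := stage_directed S1 act 4 d2 (100 * d2 ^ 4) (by norm_num)
    le_rfl h2 (by
      intro v hv
      refine le_trans (le_of_eq ?_) (hS1c v hv)
      rw [hd3]; ring)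
  obtain ⟨S3, hS3, hS3c, hp21, hp32, hp2111⟩ := stage_majority S2
    (fun v h => hirr v (hS1 v (hS2 v h))) act (2 * (k * q)) (by
      intro v hv
      refine le_trans (le_of_eq ?_) (hS2c v hv)
      rw [hd2, ← hk, hq]; ring)
  obtain ⟨S, hS, hSc, hp41⟩ := stage_four_one S3 act K k q hK hk hq.ge hS3c
  refine ⟨S, fun v => (hS v).trans ((hS3 v).trans ((hS2 v).trans (hS1 v))), hSc, ?_, ?_⟩
  · intro f hf h
    have hdir := hS1p f hf
    have hdir' := hS1p (fun i => f (-i)) (fun a b hab => neg_injective (hf hab))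
    have up : ∀ u v, u ∈ S v → u ∈ S1 v := fun u v h => hS2 v (hS3 v (hS v h))
    have h21 : ∀ w a e, a ∈ S w → e ∈ S w → e ∈ S a → False := fun w a e g1 g2 g3 =>
      hp21 w a e (hS _ g1) (hS _ g2) (hS _ g3)
    rcases h 0 with h0 | h0 <;> rcases h 1 with h1 | h1 <;> rcases h 2 with h2 | h2
    · exact hdir (fun i => by fin_cases i; exacts [up _ _ h0, up _ _ h1, up _ _ h2])
    · exact h21 _ _ _ h0 h2 h1
    · exact h21 _ _ _ h2 h1 h0
    · exact h21 _ _ _ h2 h0 h1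
    · exact h21 _ _ _ h1 h0 h2
    · exact h21 _ _ _ h0 h1 h2
    · exact h21 _ _ _ h1 h2 h0
    · exact hdir' (fun i => by fin_cases i; exacts [up _ _ h2, up _ _ h1, up _ _ h0])
  intro f hf h
  have up : ∀ u v, u ∈ S v → u ∈ S2 v := fun u v h => hS3 v (hS v h)
  have hdir0 : f 1 ∈ S (f 0) → f 2 ∈ S (f 1) → f 3 ∈ S (f 2) → f 4 ∈ S (f 3) →
      f 0 ∈ S (f 4) → False := fun h0 h1 h2 h3 h4 => hS2p f hf (fun i => by
    fin_cases i
    exacts [up _ _ h0, up _ _ h1, up _ _ h2, up _ _ h3, up _ _ h4])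
  have hdir1 : f 4 ∈ S (f 0) → f 3 ∈ S (f 4) → f 2 ∈ S (f 3) → f 1 ∈ S (f 2) →
      f 0 ∈ S (f 1) → False := fun h0 h1 h2 h3 h4 =>
    hS2p (fun i => f (-i)) (fun a b hab => neg_injective (hf hab)) (fun i => by
      fin_cases i
      exacts [up _ _ h0, up _ _ h1, up _ _ h2, up _ _ h3, up _ _ h4])
  have h41 : ∀ w a b z e : Fin 5, a ≠ w → b ≠ w → z ≠ w → a ≠ e → f a ∈ S (f w) →
      f b ∈ S (f a) → f z ∈ S (f b) → f e ∈ S (f z) → f e ∈ S (f w) → False :=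
    fun w a b z e g1 g2 g3 g4 => hp41 _ _ _ _ _ (hf.ne g1) (hf.ne g2) (hf.ne g3) (hf.ne g4)
  have h32 : ∀ w a b z e, a ∈ S w → b ∈ S a → z ∈ S b → e ∈ S w → z ∈ S e → False :=
    fun w a b z e g1 g2 g3 g4 g5 => hp32 w a b z e (hS _ g1) (hS _ g2) (hS _ g3) (hS _ g4) (hS _ g5)
  have h2111 : ∀ w a z e y, a ∈ S w → z ∈ S a → e ∈ S w → e ∈ S y → z ∈ S y → False :=
    fun w a z e y g1 g2 g3 g4 g5 => hp2111 w a z e y (hS _ g1) (hS _ g2) (hS _ g3) (hS _ g4) (hS _ g5)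
  rcases h 0 with h0 | h0 <;> rcases h 1 with h1 | h1 <;> rcases h 2 with h2 | h2 <;>
    rcases h 3 with h3 | h3 <;> rcases h 4 with h4 | h4
  · exact hdir0 h0 h1 h2 h3 h4
  · exact h41 0 1 2 3 4 (by decide) (by decide) (by decide) (by decide) h0 h1 h2 h3 h4
  · exact h41 4 0 1 2 3 (by decide) (by decide) (by decide) (by decide) h4 h0 h1 h2 h3
  · exact h32 _ _ _ _ _ h0 h1 h2 h4 h3
  · exact h41 3 4 0 1 2 (by decide) (by decide) (by decide) (by decide) h3 h4 h0 h1 h2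
  · exact h2111 _ _ _ _ _ h0 h1 h4 h3 h2
  · exact h32 _ _ _ _ _ h4 h0 h1 h3 h2
  · exact h32 _ _ _ _ _ h4 h3 h2 h0 h1
  · exact h41 2 3 4 0 1 (by decide) (by decide) (by decide) (by decide) h2 h3 h4 h0 h1
  · exact h2111 _ _ _ _ _ h2 h3 h1 h0 h4
  · exact h2111 _ _ _ _ _ h4 h0 h3 h2 h1
  · exact h2111 _ _ _ _ _ h4 h3 h0 h1 h2
  · exact h32 _ _ _ _ _ h3 h4 h0 h2 h1
  · exact h2111 _ _ _ _ _ h2 h1 h3 h4 h0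
  · exact h32 _ _ _ _ _ h3 h2 h1 h4 h0
  · exact h41 0 4 3 2 1 (by decide) (by decide) (by decide) (by decide) h4 h3 h2 h1 h0
  · exact h41 1 2 3 4 0 (by decide) (by decide) (by decide) (by decide) h1 h2 h3 h4 h0
  · exact h32 _ _ _ _ _ h1 h2 h3 h0 h4
  · exact h2111 _ _ _ _ _ h1 h2 h0 h4 h3
  · exact h32 _ _ _ _ _ h0 h4 h3 h1 h2
  · exact h2111 _ _ _ _ _ h3 h4 h2 h1 h0
  · exact h2111 _ _ _ _ _ h0 h4 h1 h2 h3
  · exact h2111 _ _ _ _ _ h3 h2 h4 h0 h1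
  · exact h41 1 0 4 3 2 (by decide) (by decide) (by decide) (by decide) h0 h4 h3 h2 h1
  · exact h32 _ _ _ _ _ h2 h3 h4 h1 h0
  · exact h32 _ _ _ _ _ h1 h0 h4 h2 h3
  · exact h2111 _ _ _ _ _ h1 h0 h2 h3 h4
  · exact h41 2 1 0 4 3 (by decide) (by decide) (by decide) (by decide) h1 h0 h4 h3 h2
  · exact h32 _ _ _ _ _ h2 h1 h0 h3 h4
  · exact h41 3 2 1 0 4 (by decide) (by decide) (by decide) (by decide) h2 h1 h0 h4 h3
  · exact h41 4 3 2 1 0 (by decide) (by decide) (by decide) (by decide) h3 h2 h1 h0 h4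
  · exact hdir1 h4 h3 h2 h1 h0

lemma local_main {α : Type} (Nf : α → Finset α) (hirr : ∀ v, v ∉ Nf v) (A : Set α) (K : ℕ)
    (hK : 1 ≤ K)
    (hN : ∀ v ∈ A, 100 * (100 * (2 ^ 18 * (23 * K ^ 4) ^ 60) ^ 5) ^ 5 ≤ (Nf v).card)
    (X : Finset α) :
    ∃ S : α → Finset α, (∀ v, S v ⊆ Nf v) ∧ (∀ v ∈ A, v ∈ X → K ≤ (S v).card) ∧
      (∀ f : Fin 3 → α, Function.Injective f →
        ¬ ∀ i, f (i + 1) ∈ S (f i) ∨ f i ∈ S (f (i + 1))) ∧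
      (∀ f : Fin 5 → α, Function.Injective f →
        ¬ ∀ i, f (i + 1) ∈ S (f i) ∨ f i ∈ S (f (i + 1))) := by
  classical
  let Y : Finset α := X ∪ X.biUnion Nf
  obtain ⟨S, hS, hSc, h3, h5⟩ := finite_main (V := {v // v ∈ Y})
    (fun v => (Nf v.1).subtype (fun u => u ∈ Y)) (fun v h => hirr v.1 (by simpa using h))
    {v | v.1 ∈ X ∧ v.1 ∈ A} K hK (by
      rintro ⟨v, hvY⟩ ⟨hvX, hvA⟩
      refine le_trans (hN v hvA) ?_
      rw [Finset.card_subtype, Finset.filter_true_of_mem]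
      intro u hu
      exact Finset.mem_union_right _ (Finset.mem_biUnion.2 ⟨v, hvX, hu⟩))
  let S' : α → Finset α := fun v => if h : v ∈ Y then
    (S ⟨v, h⟩).map (Function.Embedding.subtype _) else ∅
  have hS' : ∀ u v, u ∈ S' v → ∃ (hu : u ∈ Y) (hv : v ∈ Y), (⟨u, hu⟩ : {v // v ∈ Y}) ∈ S ⟨v, hv⟩ := by
    intro u v h
    by_cases hv : v ∈ Y
    · simp only [S', hv, dif_pos, Finset.mem_map] at h
      obtain ⟨⟨u', hu'⟩, hmem, rfl⟩ := h
      exact ⟨hu', hv, hmem⟩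
    · simp [S', hv] at h
  have lift : ∀ {n : ℕ} (f : Fin (n+1) → α), Function.Injective f →
      (∀ i, f (i + 1) ∈ S' (f i) ∨ f i ∈ S' (f (i + 1))) →
      ∃ g : Fin (n+1) → {v // v ∈ Y}, Function.Injective g ∧
        ∀ i, g (i + 1) ∈ S (g i) ∨ g i ∈ S (g (i + 1)) := by
    intro n f hf h
    have hY : ∀ i, f i ∈ Y := by
      intro i
      rcases h i with h | h
      · exact (hS' _ _ h).2.1
      · exact (hS' _ _ h).1
    refine ⟨fun i => ⟨f i, hY i⟩, fun a b hab => hf (congrArg Subtype.val hab), fun i => ?_⟩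
    rcases h i with h | h
    · exact Or.inl (hS' _ _ h).2.2
    · exact Or.inr (hS' _ _ h).2.2
  refine ⟨S', ?_, ?_, ?_, ?_⟩
  · intro v u h
    obtain ⟨hu, hv, hmem⟩ := hS' u v h
    have := hS _ hmem
    simpa using this
  · intro v hvA hvX
    have hvY : v ∈ Y := Finset.mem_union_left _ hvX
    simp only [S', hvY, dif_pos, Finset.card_map]
    exact hSc ⟨v, hvY⟩ ⟨hvX, hvA⟩
  · intro f hf h
    obtain ⟨g, hg, hg'⟩ := lift f hf h
    exact h3 g hg hg'
  · intro f hf h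
    obtain ⟨g, hg, hg'⟩ := lift f hf h
    exact h5 g hg hg'

lemma global_main {α : Type} (Nf : α → Finset α) (hirr : ∀ v, v ∉ Nf v) (A : Set α) (K : ℕ)
    (hK : 1 ≤ K)
    (hN : ∀ v ∈ A, 100 * (100 * (2 ^ 18 * (23 * K ^ 4) ^ 60) ^ 5) ^ 5 ≤ (Nf v).card) :
    ∃ S : α → Finset α, (∀ v, S v ⊆ Nf v) ∧ (∀ v ∈ A, K ≤ (S v).card) ∧
      (∀ f : Fin 3 → α, Function.Injective f →
        ¬ ∀ i, f (i + 1) ∈ S (f i) ∨ f i ∈ S (f (i + 1))) ∧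
      (∀ f : Fin 5 → α, Function.Injective f →
        ¬ ∀ i, f (i + 1) ∈ S (f i) ∨ f i ∈ S (f (i + 1))) := by
  classical
  choose T hTsub hTc hT3 hT5 using local_main Nf hirr A K hK hN
  let U : Ultrafilter (Finset α) := Ultrafilter.of Filter.atTop
  have hU : (U : Filter (Finset α)) ≤ Filter.atTop := Ultrafilter.of_le _
  have hlim : ∀ v, ∃ t ∈ ((Nf v).powerset : Set (Finset α)), ∀ᶠ X in (U : Filter (Finset α)), T X v = t := by
    intro v
    rw [← Ultrafilter.eventually_exists_mem_iff (Finset.finite_toSet _)]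
    refine Filter.Eventually.of_forall fun X => ⟨T X v, ?_, rfl⟩
    simpa using hTsub X v
  choose S hSsub hS using hlim
  have hcyc : ∀ {n : ℕ} (f : Fin (n+1) → α), ∃ X, ∀ i, T X (f i) = S (f i) := by
    intro n f
    exact (Filter.eventually_all.2 fun i => hS (f i)).exists
  refine ⟨S, fun v => by simpa using hSsub v, ?_, ?_, ?_⟩
  · intro v hv
    have h1 : ∀ᶠ X in (U : Filter (Finset α)), ({v} : Finset α) ≤ X :=
      (Filter.eventually_ge_atTop ({v} : Finset α)).filter_mono hU
    obtain ⟨X, hX1, hX2⟩ := (h1.and (hS v)).exists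
    rw [← hX2]
    exact hTc X v hv (by simpa using hX1)
  · intro f hf h
    obtain ⟨X, hX⟩ := hcyc f
    refine hT3 X f hf fun i => ?_
    rw [hX, hX]
    exact h i
  · intro f hf h
    obtain ⟨X, hX⟩ := hcyc f
    refine hT5 X f hf fun i => ?_
    rw [hX, hX]
    exact h i

lemma poly_identity (a b c g K : ℕ) :
    a * (b * (c * (g * K ^ 4) ^ 60) ^ 5) ^ 5 = a * (b * (c * g ^ 60) ^ 5) ^ 5 * K ^ 6000 := by
  ring

/-- There is a polynomially bounded `f : ℕ → ℕ` such that every digraph of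
minimum out-degree at least `f k` contains a subdigraph of minimum out-degree
at least `k` whose underlying undirected graph has odd-girth at least 7,
i.e. contains no cycle of length 3 or 5. -/
theorem subdigraph_of_odd_girth_seven :
    ∃ f : ℕ → ℕ, (∃ C n : ℕ, ∀ k : ℕ, f k ≤ C * (k + 1) ^ n) ∧
      ∀ (k : ℕ) (α : Type) (D : Digraph' α), D.verts.Nonempty →
        D.MinOutDegAtLeast (f k) →
        ∃ D' : Digraph' α, D'.IsSubdigraph D ∧ D'.verts.Nonempty ∧
          D'.MinOutDegAtLeast k ∧ ¬ HasUCycle D' 3 ∧ ¬ HasUCycle D' 5 := by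
  refine ⟨fun k => 100 * (100 * (2 ^ 18 * (23 * (k + 1) ^ 4) ^ 60) ^ 5) ^ 5,
    ⟨100 * (100 * (2 ^ 18 * 23 ^ 60) ^ 5) ^ 5, 6000,
      fun k => (poly_identity 100 100 (2 ^ 18) 23 (k + 1)).le⟩, ?_⟩
  intro k α D hne hD
  classical
  have hpick : ∀ v, ∃ t : Finset α, (∀ u ∈ t, D.Adj v u) ∧
      (v ∈ D.verts → 100 * (100 * (2 ^ 18 * (23 * (k + 1) ^ 4) ^ 60) ^ 5) ^ 5 ≤ t.card) := by
    intro v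
    by_cases hv : v ∈ D.verts
    · obtain ⟨t, ht, hc⟩ := hD v hv
      exact ⟨t, fun u hu => ht hu, fun _ => hc⟩
    · exact ⟨∅, by simp, fun h => absurd h hv⟩
  choose Nf hNf hNfc using hpick
  obtain ⟨S, hS, hSc, h3, h5⟩ := global_main Nf (fun v h => D.ne_of_adj (hNf v v h) rfl) D.verts
    (k + 1) (by omega) hNfc
  have hadj : ∀ u v, u ∈ S v → D.Adj v u := fun u v h => hNf v u (hS v h)
  refine ⟨⟨D.verts, fun v u => u ∈ S v, fun v u h => D.ne_of_adj (hadj u v h),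
    fun v u h => D.mem_verts_left (hadj u v h), fun v u h => D.mem_verts_right (hadj u v h)⟩,
    ⟨subset_rfl, fun v u h => hadj u v h⟩, hne, ?_, ?_, ?_⟩
  · intro v hv
    exact ⟨S v, fun u hu => hu, by have := hSc v hv; omega⟩
  · rintro ⟨-, f, hinj, -, hcyc⟩
    refine h3 (fun i => f i.val) (fun a b hab => Fin.ext (hinj _ _ a.isLt b.isLt hab)) fun i => ?_
    have := hcyc i.val i.isLt
    rw [Fin.val_add]
    exact this
  · rintro ⟨-, f, hinj, -, hcyc⟩
    refine h5 (fun i => f i.val) (fun a b hab => Fin.ext (hinj _ _ a.isLt b.isLt hab)) fun i => ?_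
    have := hcyc i.val i.isLt
    rw [Fin.val_add]
    exact this
end
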